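/- arXiv:2304.14112 — 2 statements merged into one kernel-verified Lean document; each statement's English description precedes it below -/
import Mathlib

section
/- Let n, k ≥ 1 and let A(D) be a homogeneous linear differential operator of order k on ℝⁿ from V to E which is injectively elliptic. Then there exists a constant C ∈ (0,∞) such that for every u ∈ C^∞_c(ℝⁿ, V) one has ∫_{ℝⁿ} |D^k u|² ≤ C ∫_{ℝⁿ} |A(D)u|². -/
open MeasureTheory

noncomputable section

/-- First-order partial derivative in the `i`-th coordinate direction. -/
def pd {n : ℕ} {V : Type*} [NormedAddCommGroup V] [NormedSpace ℝ V] (i : Fin n)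
    (u : EuclideanSpace ℝ (Fin n) → V) : EuclideanSpace ℝ (Fin n) → V :=
  fun x => fderiv ℝ u x (EuclideanSpace.single i 1)

/-- Iterated partial derivative `∂^α`. -/
def pdMulti {n : ℕ} {V : Type*} [NormedAddCommGroup V] [NormedSpace ℝ V] (α : Fin n → ℕ)
    (u : EuclideanSpace ℝ (Fin n) → V) : EuclideanSpace ℝ (Fin n) → V :=
  (List.finRange n).foldr (fun i v => (pd i)^[α i] v) u

/-- The homogeneous differential operator `A(D) = ∑_{|α|=k} A_α ∂^α` applied to `u`. -/
def opApply {n : ℕ} {V E : Type*} [NormedAddCommGroup V] [NormedSpace ℝ V]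
    [NormedAddCommGroup E] [NormedSpace ℝ E]
    (k : ℕ) (A : (Fin n → ℕ) → (V →ₗ[ℝ] E))
    (u : EuclideanSpace ℝ (Fin n) → V) : EuclideanSpace ℝ (Fin n) → E :=
  fun x => ∑ α ∈ Finset.Nat.antidiagonalTuple n k, A α (pdMulti α u x)

/-- The symbol `A(ξ) = ∑_{|α|=k} ξ^α A_α` of the operator. -/
def symb {n : ℕ} {V E : Type*} [NormedAddCommGroup V] [NormedSpace ℝ V]
    [NormedAddCommGroup E] [NormedSpace ℝ E]
    (k : ℕ) (A : (Fin n → ℕ) → (V →ₗ[ℝ] E)) (ξ : EuclideanSpace ℝ (Fin n)) :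
    V →ₗ[ℝ] E :=
  ∑ α ∈ Finset.Nat.antidiagonalTuple n k, (∏ i, ξ i ^ α i) • A α


open scoped FourierTransform SchwartzMap LineDeriv

section Complexification

/-- Real coordinates, seen as complex numbers. -/
def cplx (V : Type*) [NormedAddCommGroup V] [InnerProductSpace ℝ V] [FiniteDimensional ℝ V] :
    V →ₗᵢ[ℝ] EuclideanSpace ℂ (Fin (Module.finrank ℝ V)) where
  toFun v := WithLp.toLp 2 fun j => (((stdOrthonormalBasis ℝ V).repr v j : ℝ) : ℂ)
  map_add' a b := by ext j; simp
  map_smul' a b := by ext j; simp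
  norm_map' v := by
    rw [← (stdOrthonormalBasis ℝ V).repr.norm_map v, EuclideanSpace.norm_eq,
      EuclideanSpace.norm_eq]
    simp

variable {V E : Type*} [NormedAddCommGroup V] [InnerProductSpace ℝ V] [FiniteDimensional ℝ V]
    [NormedAddCommGroup E] [InnerProductSpace ℝ E] [FiniteDimensional ℝ E]

/-- Real part. -/
def rePart (w : EuclideanSpace ℂ (Fin (Module.finrank ℝ V))) : V :=
  (stdOrthonormalBasis ℝ V).repr.symm (WithLp.toLp 2 fun j => (w j).re)

/-- Imaginary part. -/
def imPart (w : EuclideanSpace ℂ (Fin (Module.finrank ℝ V))) : V :=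
  (stdOrthonormalBasis ℝ V).repr.symm (WithLp.toLp 2 fun j => (w j).im)

lemma cplx_apply (v : V) (j) :
    cplx V v j = (((stdOrthonormalBasis ℝ V).repr v j : ℝ) : ℂ) := rfl

lemma rePart_cplx (v : V) : rePart (cplx V v) = v := by
  simp [rePart, cplx_apply]

lemma imPart_cplx (v : V) : imPart (cplx V v) = 0 := by
  rw [imPart, LinearIsometryEquiv.symm_apply_eq]
  ext j
  simp [cplx_apply]

lemma norm_sq_parts (w : EuclideanSpace ℂ (Fin (Module.finrank ℝ V))) :
    ‖w‖ ^ 2 = ‖rePart (V := V) w‖ ^ 2 + ‖imPart (V := V) w‖ ^ 2 := by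
  simp only [rePart, imPart, LinearIsometryEquiv.norm_map, EuclideanSpace.norm_sq_eq,
    ← Finset.sum_add_distrib]
  refine Finset.sum_congr rfl fun j _ => ?_
  rw [Complex.sq_norm, Complex.normSq_apply]
  simp [sq]

lemma norm_sq_cplx_add (a b : V) :
    ‖cplx V a + Complex.I • cplx V b‖ ^ 2 = ‖a‖ ^ 2 + ‖b‖ ^ 2 := by
  rw [norm_sq_parts (V := V)]
  congr 3
  · rw [rePart, LinearIsometryEquiv.symm_apply_eq]
    ext j
    simp [cplx_apply]
  · rw [imPart, LinearIsometryEquiv.symm_apply_eq]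
    ext j
    simp [cplx_apply]

lemma rePart_add (w z : EuclideanSpace ℂ (Fin (Module.finrank ℝ V))) :
    rePart (V := V) (w + z) = rePart w + rePart z := by
  simp only [rePart]
  rw [← map_add]
  congr 1

lemma imPart_add (w z : EuclideanSpace ℂ (Fin (Module.finrank ℝ V))) :
    imPart (V := V) (w + z) = imPart w + imPart z := by
  simp only [imPart]
  rw [← map_add]
  congr 1

lemma rePart_smul (c : ℂ) (w : EuclideanSpace ℂ (Fin (Module.finrank ℝ V))) :
    rePart (V := V) (c • w) = c.re • rePart w - c.im • imPart w := by
  simp only [rePart, imPart]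
  rw [← map_smul, ← map_smul, ← map_sub]
  congr 1

lemma imPart_smul (c : ℂ) (w : EuclideanSpace ℂ (Fin (Module.finrank ℝ V))) :
    imPart (V := V) (c • w) = c.re • imPart w + c.im • rePart w := by
  simp only [rePart, imPart]
  rw [← map_smul, ← map_smul, ← map_add]
  congr 1

/-- Complexification of a linear map. -/
def cplxMap (A : V →ₗ[ℝ] E) : EuclideanSpace ℂ (Fin (Module.finrank ℝ V)) →L[ℂ]
    EuclideanSpace ℂ (Fin (Module.finrank ℝ E)) :=
  LinearMap.toContinuousLinearMap
  { toFun := fun w => cplx E (A (rePart w)) + Complex.I • cplx E (A (imPart w))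
    map_add' := fun w z => by
      simp only [rePart_add, imPart_add, map_add, smul_add]
      abel
    map_smul' := fun c w => by
      simp only [rePart_smul, imPart_smul, map_add, map_sub, map_smul, RingHom.id_apply]
      ext j
      simp only [PiLp.add_apply, PiLp.sub_apply, PiLp.smul_apply, Complex.real_smul, smul_eq_mul]
      conv_rhs => rw [← Complex.re_add_im c]
      linear_combination (-(c.im : ℂ) * (cplx E (A (imPart w)) j)) * Complex.I_mul_I }

lemma cplxMap_apply (A : V →ₗ[ℝ] E) (w) :
    cplxMap A w = cplx E (A (rePart w)) + Complex.I • cplx E (A (imPart w)) := rfl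

lemma cplxMap_cplx (A : V →ₗ[ℝ] E) (v : V) : cplxMap A (cplx V v) = cplx E (A v) := by
  simp [cplxMap_apply, rePart_cplx, imPart_cplx]

lemma norm_sq_cplxMap (A : V →ₗ[ℝ] E) (w) :
    ‖cplxMap A w‖ ^ 2 = ‖A (rePart w)‖ ^ 2 + ‖A (imPart w)‖ ^ 2 := by
  rw [cplxMap_apply, norm_sq_cplx_add]

lemma cplxMap_sum {ι : Type*} (s : Finset ι) (c : ι → ℝ) (A : ι → V →ₗ[ℝ] E) (w) :
    cplxMap (∑ α ∈ s, c α • A α) w = ∑ α ∈ s, (c α : ℂ) • cplxMap (A α) w := by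
  simp only [cplxMap_apply, LinearMap.sum_apply, LinearMap.smul_apply, map_sum, map_smul,
    smul_add, Finset.sum_add_distrib, Finset.smul_sum]
  congr 1
  refine Finset.sum_congr rfl fun α _ => ?_
  ext j
  simp
  ring

end Complexification

section Symbol

variable {V E : Type*} [NormedAddCommGroup V] [InnerProductSpace ℝ V] [FiniteDimensional ℝ V]
    [NormedAddCommGroup E] [InnerProductSpace ℝ E] [FiniteDimensional ℝ E]

lemma symb_apply {n : ℕ} (k : ℕ) (A : (Fin n → ℕ) → (V →ₗ[ℝ] E)) (ξ v) :
    symb k A ξ v = ∑ α ∈ Finset.Nat.antidiagonalTuple n k, (∏ i, ξ i ^ α i) • A α v := by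
  simp [symb, LinearMap.sum_apply]

lemma symb_smul {n : ℕ} (k : ℕ) (A : (Fin n → ℕ) → (V →ₗ[ℝ] E)) (t : ℝ) (ξ v) :
    symb k A (t • ξ) v = t ^ k • symb k A ξ v := by
  rw [symb_apply, symb_apply, Finset.smul_sum]
  refine Finset.sum_congr rfl fun α hα => ?_
  rw [Finset.Nat.mem_antidiagonalTuple] at hα
  rw [smul_smul]
  congr 1
  simp [mul_pow, Finset.prod_mul_distrib, Finset.prod_pow_eq_pow_sum, hα]

lemma continuous_symb {n : ℕ} (k : ℕ) (A : (Fin n → ℕ) → (V →ₗ[ℝ] E)) :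
    Continuous fun p : EuclideanSpace ℝ (Fin n) × V => symb k A p.1 p.2 := by
  simp only [symb_apply]
  refine continuous_finsetSum _ fun α _ => ?_
  refine Continuous.smul (by fun_prop) ?_
  exact (A α).continuous_of_finiteDimensional.comp continuous_snd

lemma symb_bound {n k : ℕ} (hk : 1 ≤ k) (A : (Fin n → ℕ) → (V →ₗ[ℝ] E))
    (hell : ∀ ξ : EuclideanSpace ℝ (Fin n), ξ ≠ 0 → Function.Injective (symb k A ξ)) :
    ∃ c : ℝ, 0 < c ∧ ∀ ξ v, c * (‖ξ‖ ^ k * ‖v‖) ≤ ‖symb k A ξ v‖ := by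
  obtain ⟨c, hc, h⟩ : ∃ c : ℝ, 0 < c ∧ ∀ ξ : EuclideanSpace ℝ (Fin n), ∀ v : V,
      ‖ξ‖ = 1 → ‖v‖ = 1 → c ≤ ‖symb k A ξ v‖ := by
    have hK : IsCompact ((Metric.sphere (0 : EuclideanSpace ℝ (Fin n)) 1) ×ˢ
      (Metric.sphere (0 : V) 1)) := (isCompact_sphere _ _).prod (isCompact_sphere _ _)
    rcases Set.eq_empty_or_nonempty ((Metric.sphere (0 : EuclideanSpace ℝ (Fin n)) 1) ×ˢ
      (Metric.sphere (0 : V) 1)) with h0 | h0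
    · refine ⟨1, one_pos, fun ξ v h1 h2 => ?_⟩
      have : (ξ, v) ∈ ((Metric.sphere (0 : EuclideanSpace ℝ (Fin n)) 1) ×ˢ
        (Metric.sphere (0 : V) 1)) := by simp [h1, h2]
      simp [h0] at this
    · obtain ⟨p, hp, hmin⟩ := hK.exists_isMinOn h0 (continuous_symb k A).norm.continuousOn
      simp only [Set.mem_prod, mem_sphere_iff_norm, sub_zero] at hp
      refine ⟨‖symb k A p.1 p.2‖, ?_, fun ξ v h1 h2 => ?_⟩
      · rw [norm_pos_iff]
        intro h
        have h1 : p.1 ≠ 0 := by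
          intro h; simp [h] at hp
        have h2 : p.2 = 0 := hell p.1 h1 (by simpa using h)
        simp [h2] at hp
      · exact hmin (a := (ξ, v)) (by simp [h1, h2])
  refine ⟨c, hc, fun ξ v => ?_⟩
  by_cases hξ : ξ = 0
  · simp [hξ, show k ≠ 0 by omega]
  by_cases hv : v = 0
  · simp [hv]
  have hξ' : ‖ξ‖ ≠ 0 := by simpa using hξ
  have hv' : ‖v‖ ≠ 0 := by simpa using hv
  have h1 : ξ = ‖ξ‖ • (‖ξ‖⁻¹ • ξ) := by rw [smul_smul, mul_inv_cancel₀ hξ', one_smul]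
  have h2 : v = ‖v‖ • (‖v‖⁻¹ • v) := by rw [smul_smul, mul_inv_cancel₀ hv', one_smul]
  have h3 : ‖symb k A ξ v‖ = (‖ξ‖ ^ k * ‖v‖) * ‖symb k A (‖ξ‖⁻¹ • ξ) (‖v‖⁻¹ • v)‖ := by
    conv_lhs => rw [h1, h2, symb_smul, map_smul, norm_smul, norm_smul]
    simp [mul_assoc]
  rw [h3, mul_comm c]
  refine mul_le_mul_of_nonneg_left (h _ _ ?_ ?_) (by positivity)
  · simp [norm_smul, hξ']
  · simp [norm_smul, hv']

lemma cplx_symb_bound {n k : ℕ} (hk : 1 ≤ k) (A : (Fin n → ℕ) → (V →ₗ[ℝ] E))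
    (hell : ∀ ξ : EuclideanSpace ℝ (Fin n), ξ ≠ 0 → Function.Injective (symb k A ξ)) :
    ∃ C : ℝ, 0 < C ∧ ∀ ξ w, (‖ξ‖ ^ k * ‖w‖) ^ 2 ≤ C * ‖cplxMap (symb k A ξ) w‖ ^ 2 := by
  obtain ⟨c, hc, h⟩ := symb_bound hk A hell
  refine ⟨(c ^ 2)⁻¹, by positivity, fun ξ w => ?_⟩
  rw [le_inv_mul_iff₀ (by positivity), norm_sq_cplxMap, mul_pow, norm_sq_parts (V := V) w]
  have h1 := pow_le_pow_left₀ (by positivity) (h ξ (rePart w)) 2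
  have h2 := pow_le_pow_left₀ (by positivity) (h ξ (imPart w)) 2
  nlinarith

end Symbol

section Multilinear

lemma norm_multilinear_le {n k : ℕ} {F : Type*} [NormedAddCommGroup F] [NormedSpace ℝ F]
    (M : ContinuousMultilinearMap ℝ (fun _ : Fin k => EuclideanSpace ℝ (Fin n)) F) :
    ‖M‖ ≤ ∑ m : Fin k → Fin n, ‖M fun j => EuclideanSpace.single (m j) 1‖ := by
  refine M.opNorm_le_bound (by positivity) fun x => ?_
  have hx : x = fun j => ∑ i, x j i • EuclideanSpace.single i (1 : ℝ) := by
    funext j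
    ext l
    simp [Finset.sum_apply, Pi.single_apply]
  conv_lhs => rw [hx, M.map_sum]
  rw [Finset.sum_mul]
  refine (norm_sum_le _ _).trans (Finset.sum_le_sum fun m _ => ?_)
  rw [M.map_smul_univ fun j => x j (m j), norm_smul, mul_comm, norm_prod]
  gcongr with j
  exact PiLp.norm_apply_le (x j) (m j)

lemma norm_sq_multilinear_le {n k : ℕ} {F : Type*} [NormedAddCommGroup F] [NormedSpace ℝ F]
    (M : ContinuousMultilinearMap ℝ (fun _ : Fin k => EuclideanSpace ℝ (Fin n)) F) :
    ‖M‖ ^ 2 ≤ (Fintype.card (Fin k → Fin n) : ℝ) *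
      ∑ m : Fin k → Fin n, ‖M fun j => EuclideanSpace.single (m j) 1‖ ^ 2 := by
  refine (pow_le_pow_left₀ (norm_nonneg _) (norm_multilinear_le M) 2).trans ?_
  exact sq_sum_le_card_mul_sum_sq

end Multilinear

section Schwartz

variable {n : ℕ} {F G : Type*} [NormedAddCommGroup F] [InnerProductSpace ℂ F] [CompleteSpace F]
  [NormedAddCommGroup G] [InnerProductSpace ℂ G] [CompleteSpace G]

lemma fourier_line (f : 𝓢(EuclideanSpace ℝ (Fin n), F)) (i : Fin n) (ξ) :
    𝓕 (∂_{(EuclideanSpace.single i (1 : ℝ))} f) ξ =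
      ((2 * Real.pi * Complex.I) * (ξ i : ℂ)) • 𝓕 f ξ := by
  rw [SchwartzMap.fourier_lineDerivOp_eq]
  have : (inner ℝ · (EuclideanSpace.single i (1 : ℝ))).HasTemperateGrowth := by fun_prop
  rw [_root_.smul_apply, SchwartzMap.smulLeftCLM_apply_apply this, mul_smul _ (ξ i : ℂ)]
  congr 1
  simp [EuclideanSpace.inner_single_right]

lemma fourier_iterLine {k : ℕ} (m : Fin k → Fin n) (f : 𝓢(EuclideanSpace ℝ (Fin n), F)) (ξ) :
    𝓕 (∂^{fun j => EuclideanSpace.single (m j) (1 : ℝ)} f) ξ =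
      ((2 * Real.pi * Complex.I) ^ k * (∏ j, ξ (m j) : ℝ)) • 𝓕 f ξ := by
  induction k with
  | zero => simp
  | succ k ih =>
    rw [LineDeriv.iteratedLineDerivOp_succ_left, fourier_line]
    have := ih (Fin.tail m)
    simp only [Fin.tail_def] at this ⊢
    rw [this, smul_smul, Fin.prod_univ_succ]
    congr 1
    push_cast
    ring

lemma fourier_iter (a : ℕ) (i : Fin n) (f : 𝓢(EuclideanSpace ℝ (Fin n), F)) (ξ) :
    𝓕 ((fun g : 𝓢(EuclideanSpace ℝ (Fin n), F) =>
        ∂_{(EuclideanSpace.single i (1 : ℝ))} g)^[a] f) ξ =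
      ((2 * Real.pi * Complex.I) ^ a * (ξ i ^ a : ℝ)) • 𝓕 f ξ := by
  induction a with
  | zero => simp
  | succ a ih =>
    rw [Function.iterate_succ_apply', fourier_line, ih, smul_smul]
    congr 1
    push_cast
    ring

/-- Schwartz version of iterated partial derivatives. -/
def sMulti {F : Type*} [NormedAddCommGroup F] [NormedSpace ℝ F]
    (l : List (Fin n)) (α : Fin n → ℕ) (f : 𝓢(EuclideanSpace ℝ (Fin n), F)) :
    𝓢(EuclideanSpace ℝ (Fin n), F) :=
  l.foldr (fun i v => (fun g : 𝓢(EuclideanSpace ℝ (Fin n), F) =>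
    ∂_{(EuclideanSpace.single i (1 : ℝ))} g)^[α i] v) f

lemma fourier_sMulti (l : List (Fin n)) (α : Fin n → ℕ)
    (f : 𝓢(EuclideanSpace ℝ (Fin n), F)) (ξ) :
    𝓕 (sMulti l α f) ξ = ((2 * Real.pi * Complex.I) ^ (l.map α).sum *
      ((l.map fun i => ξ i ^ α i).prod : ℝ)) • 𝓕 f ξ := by
  induction l with
  | nil => simp [sMulti]
  | cons i l ih =>
    have : sMulti (i :: l) α f = (fun g : 𝓢(EuclideanSpace ℝ (Fin n), F) =>
      ∂_{(EuclideanSpace.single i (1 : ℝ))} g)^[α i] (sMulti l α f) := rfl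
    rw [this, fourier_iter, ih, smul_smul]
    congr 1
    simp only [List.map_cons, List.sum_cons, List.prod_cons]
    push_cast
    ring

lemma coe_iter {F : Type*} [NormedAddCommGroup F] [NormedSpace ℝ F]
    (a : ℕ) (i : Fin n) (f : 𝓢(EuclideanSpace ℝ (Fin n), F)) :
    ⇑((fun g : 𝓢(EuclideanSpace ℝ (Fin n), F) =>
        ∂_{(EuclideanSpace.single i (1 : ℝ))} g)^[a] f) = (pd i)^[a] ⇑f := by
  induction a with
  | zero => rfl
  | succ a ih =>
    rw [Function.iterate_succ_apply', Function.iterate_succ_apply', ← ih]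
    rfl

lemma coe_sMulti {F : Type*} [NormedAddCommGroup F] [NormedSpace ℝ F]
    (l : List (Fin n)) (α : Fin n → ℕ) (f : 𝓢(EuclideanSpace ℝ (Fin n), F)) :
    ⇑(sMulti l α f) = l.foldr (fun i v => (pd i)^[α i] v) ⇑f := by
  induction l with
  | nil => rfl
  | cons i l ih =>
    have : sMulti (i :: l) α f = (fun g : 𝓢(EuclideanSpace ℝ (Fin n), F) =>
      ∂_{(EuclideanSpace.single i (1 : ℝ))} g)^[α i] (sMulti l α f) := rfl
    rw [this, coe_iter, ih]
    rfl

lemma line_postcomp {F G : Type*} [NormedAddCommGroup F] [NormedSpace ℝ F]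
    [NormedAddCommGroup G] [NormedSpace ℝ G] (L : F →L[ℝ] G) (i : Fin n)
    (f : 𝓢(EuclideanSpace ℝ (Fin n), F)) :
    ∂_{(EuclideanSpace.single i (1 : ℝ))} (f.postcompCLM L) =
      (∂_{(EuclideanSpace.single i (1 : ℝ))} f).postcompCLM L := by
  ext x
  rw [SchwartzMap.postcompCLM_apply, SchwartzMap.lineDerivOp_apply_eq_fderiv,
    SchwartzMap.lineDerivOp_apply_eq_fderiv]
  have : (⇑(f.postcompCLM L)) = L ∘ f := rfl
  rw [this, fderiv_comp x L.differentiableAt f.differentiableAt, L.fderiv]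
  rfl

lemma iter_postcomp {F G : Type*} [NormedAddCommGroup F] [NormedSpace ℝ F]
    [NormedAddCommGroup G] [NormedSpace ℝ G] (L : F →L[ℝ] G) (a : ℕ) (i : Fin n)
    (f : 𝓢(EuclideanSpace ℝ (Fin n), F)) :
    (fun g : 𝓢(EuclideanSpace ℝ (Fin n), G) =>
        ∂_{(EuclideanSpace.single i (1 : ℝ))} g)^[a] (f.postcompCLM L) =
      ((fun g : 𝓢(EuclideanSpace ℝ (Fin n), F) =>
        ∂_{(EuclideanSpace.single i (1 : ℝ))} g)^[a] f).postcompCLM L := by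
  induction a with
  | zero => rfl
  | succ a ih =>
    rw [Function.iterate_succ_apply', Function.iterate_succ_apply', ih, line_postcomp]

lemma sMulti_postcomp {F G : Type*} [NormedAddCommGroup F] [NormedSpace ℝ F]
    [NormedAddCommGroup G] [NormedSpace ℝ G] (L : F →L[ℝ] G) (l : List (Fin n)) (α : Fin n → ℕ)
    (f : 𝓢(EuclideanSpace ℝ (Fin n), F)) :
    sMulti l α (f.postcompCLM L) = (sMulti l α f).postcompCLM L := by
  induction l with
  | nil => rfl
  | cons i l ih =>
    change (fun g : 𝓢(EuclideanSpace ℝ (Fin n), G) =>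
      ∂_{(EuclideanSpace.single i (1 : ℝ))} g)^[α i] (sMulti l α (f.postcompCLM L)) = _
    rw [ih, iter_postcomp]
    rfl

lemma fourier_postcomp (L : F →L[ℂ] G) (f : 𝓢(EuclideanSpace ℝ (Fin n), F)) (ξ) :
    𝓕 (f.postcompCLM L) ξ = L (𝓕 f ξ) := by
  rw [SchwartzMap.fourier_coe, SchwartzMap.fourier_coe, Real.fourier_eq, Real.fourier_eq,
    ← L.integral_comp_comm]
  · simp [Circle.smul_def]
  · exact (Real.fourierIntegral_convergent_iff _).mpr f.integrable

lemma integrable_sq (f : 𝓢(EuclideanSpace ℝ (Fin n), F)) :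
    Integrable fun x => ‖f x‖ ^ 2 := by
  simpa using (f.memLp 2).integrable_norm_pow (by norm_num)

end Schwartz

/-- If `A(D)` is an injectively elliptic homogeneous linear differential operator of
order `k` on `ℝⁿ` from `V` to `E`, then there is a constant `C > 0` such that
`∫ |D^k u|² ≤ C ∫ |A(D)u|²` for all `u ∈ C^∞_c(ℝⁿ, V)`. -/
theorem stmt0
    {V E : Type*} [NormedAddCommGroup V] [InnerProductSpace ℝ V] [FiniteDimensional ℝ V]
    [NormedAddCommGroup E] [InnerProductSpace ℝ E] [FiniteDimensional ℝ E]
    (n k : ℕ) (hn : 1 ≤ n) (hk : 1 ≤ k)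
    (A : (Fin n → ℕ) → (V →ₗ[ℝ] E))
    (hell : ∀ ξ : EuclideanSpace ℝ (Fin n), ξ ≠ 0 → Function.Injective (symb k A ξ)) :
    ∃ C : ℝ, 0 < C ∧ ∀ u : EuclideanSpace ℝ (Fin n) → V,
      ContDiff ℝ (⊤ : ℕ∞) u → HasCompactSupport u →
      ∫ x, ‖iteratedFDeriv ℝ k u x‖ ^ 2 ≤ C * ∫ x, ‖opApply k A u x‖ ^ 2 := by
  obtain ⟨C, hC, hCb⟩ := cplx_symb_bound hk A hell
  set N : ℝ := (Fintype.card (Fin k → Fin n) : ℝ) with hN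
  refine ⟨N * (N * C) + 1, by positivity, fun u hu hc => ?_⟩
  set f₀ : 𝓢(EuclideanSpace ℝ (Fin n), V) := hc.toSchwartzMap hu with hf₀
  have hf₀c : ⇑f₀ = u := rfl
  set LV : V →L[ℝ] EuclideanSpace ℂ (Fin (Module.finrank ℝ V)) :=
    (cplx V).toContinuousLinearMap with hLV
  set f : 𝓢(EuclideanSpace ℝ (Fin n), EuclideanSpace ℂ (Fin (Module.finrank ℝ V))) :=
    f₀.postcompCLM LV with hf
  have hfc : ⇑f = cplx V ∘ u := rfl
  set g : 𝓢(EuclideanSpace ℝ (Fin n), EuclideanSpace ℂ (Fin (Module.finrank ℝ E))) :=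
    ∑ α ∈ Finset.Nat.antidiagonalTuple n k,
      (sMulti (List.finRange n) α f).postcompCLM (cplxMap (A α)) with hg
  have hgx : ∀ x, g x = cplx E (opApply k A u x) := by
    intro x
    rw [hg, _root_.sum_apply, opApply, map_sum]
    refine Finset.sum_congr rfl fun α _ => ?_
    rw [SchwartzMap.postcompCLM_apply, hf, sMulti_postcomp, SchwartzMap.postcompCLM_apply,
      coe_sMulti, hf₀c]
    exact cplxMap_cplx _ _
  have hgξ : ∀ ξ, 𝓕 g ξ = (2 * Real.pi * Complex.I) ^ k • cplxMap (symb k A ξ) (𝓕 f ξ) := by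
    intro ξ
    have h1 : 𝓕 g = ∑ α ∈ Finset.Nat.antidiagonalTuple n k,
        𝓕 ((sMulti (List.finRange n) α f).postcompCLM (cplxMap (A α))) := by
      rw [hg]
      exact map_sum (SchwartzMap.fourierTransformCLM ℂ) _ _
    rw [h1, _root_.sum_apply, symb, cplxMap_sum, Finset.smul_sum]
    refine Finset.sum_congr rfl fun α hα => ?_
    rw [Finset.Nat.mem_antidiagonalTuple] at hα
    rw [fourier_postcomp, fourier_sMulti, map_smul, smul_smul]
    congr 2
    rw [← hα, ← List.ofFn_eq_map, List.sum_ofFn]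
  have hnorm : ∀ x, ‖iteratedFDeriv ℝ k u x‖ ^ 2 ≤
      N * ∑ m : Fin k → Fin n, ‖(∂^{fun j => EuclideanSpace.single (m j) (1 : ℝ)} f) x‖ ^ 2 := by
    intro x
    rw [← (cplx V).norm_iteratedFDeriv_comp_left (n := ((⊤ : ℕ∞) : WithTop ℕ∞)) hu.contDiffAt
      (by exact_mod_cast le_top), ← hfc]
    refine (norm_sq_multilinear_le _).trans_eq ?_
    simp only [SchwartzMap.iteratedLineDerivOp_eq_iteratedFDeriv, hN]
  have hm : ∀ m : Fin k → Fin n,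
      ∫ x, ‖(∂^{fun j => EuclideanSpace.single (m j) (1 : ℝ)} f) x‖ ^ 2 ≤
        C * ∫ x, ‖opApply k A u x‖ ^ 2 := by
    intro m
    have h2 : ∫ x, ‖opApply k A u x‖ ^ 2 = ∫ x, ‖g x‖ ^ 2 := by
      simp only [hgx, LinearIsometry.norm_map]
    rw [h2, ← SchwartzMap.integral_norm_sq_fourier g, ← SchwartzMap.integral_norm_sq_fourier (∂^{_} f),
      ← integral_const_mul]
    refine integral_mono (integrable_sq _) ((integrable_sq _).const_mul C) fun ξ => ?_
    simp only [hgξ, fourier_iterLine, norm_smul, norm_mul, mul_pow]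
    have h3 := hCb ξ (𝓕 f ξ)
    have h4 : ‖((∏ j, ξ (m j) : ℝ) : ℂ)‖ ≤ ‖ξ‖ ^ k := by
      rw [Complex.norm_real, norm_prod]
      calc ∏ j, ‖ξ (m j)‖ ≤ ∏ j : Fin k, ‖ξ‖ :=
            Finset.prod_le_prod (fun _ _ => norm_nonneg _)
              fun j _ => PiLp.norm_apply_le ξ (m j)
        _ = ‖ξ‖ ^ k := by simp
    have h5 : ‖((∏ j, ξ (m j) : ℝ) : ℂ)‖ ^ 2 * ‖𝓕 f ξ‖ ^ 2 ≤
        C * ‖cplxMap (symb k A ξ) (𝓕 f ξ)‖ ^ 2 := by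
      refine le_trans ?_ h3
      rw [mul_pow]
      gcongr
    have h6 := mul_le_mul_of_nonneg_left h5
      (sq_nonneg ‖(2 * (Real.pi : ℂ) * Complex.I) ^ k‖)
    simp only [norm_mul, mul_pow, norm_pow] at h6 ⊢
    linarith
  have hI : 0 ≤ ∫ x, ‖opApply k A u x‖ ^ 2 := integral_nonneg fun x => by positivity
  calc ∫ x, ‖iteratedFDeriv ℝ k u x‖ ^ 2
      ≤ ∫ x, N * ∑ m : Fin k → Fin n,
          ‖(∂^{fun j => EuclideanSpace.single (m j) (1 : ℝ)} f) x‖ ^ 2 := by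
        refine integral_mono_of_nonneg (Filter.Eventually.of_forall fun x => by positivity) ?_
          (Filter.Eventually.of_forall hnorm)
        exact (integrable_finsetSum _ fun m _ => integrable_sq _).const_mul N
    _ = N * ∑ m : Fin k → Fin n,
          ∫ x, ‖(∂^{fun j => EuclideanSpace.single (m j) (1 : ℝ)} f) x‖ ^ 2 := by
        rw [integral_const_mul, integral_finsetSum _ fun m _ => integrable_sq _]
    _ ≤ N * ∑ m : Fin k → Fin n, C * ∫ x, ‖opApply k A u x‖ ^ 2 := by
        gcongr with m
        exact hm m
    _ = N * (N * C) * ∫ x, ‖opApply k A u x‖ ^ 2 := by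
        rw [Finset.sum_const, Finset.card_univ, nsmul_eq_mul]
        ring
    _ ≤ (N * (N * C) + 1) * ∫ x, ‖opApply k A u x‖ ^ 2 := by
        nlinarith

end
end

section
/- Let n, k ≥ 1, let 1 < p < ∞, and let A(D) be a homogeneous linear differential operator of order k on ℝⁿ from V to E which is injectively elliptic. Then there exists a constant C ∈ (0,∞), depending only on n, p and A, such that for every u ∈ C^∞_c(ℝⁿ, V) one has ∫_{ℝⁿ} |D^k u|^p ≤ C ∫_{ℝⁿ} |A(D)u|^p. -/
open MeasureTheory

noncomputable section

namespace CZ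
open scoped ENNReal NNReal

/-- index of the cube of side `s` containing `x`. -/
def idx {n : ℕ} (s : ℝ) (x : EuclideanSpace ℝ (Fin n)) : Fin n → ℤ := fun i => ⌊x i / s⌋

def cube {n : ℕ} (s : ℝ) (z : Fin n → ℤ) : Set (EuclideanSpace ℝ (Fin n)) := {x | idx s x = z}

lemma cube_eq {n : ℕ} {s : ℝ} (hs : 0 < s) (z : Fin n → ℤ) :
    cube s z = (WithLp.ofLp : EuclideanSpace ℝ (Fin n) → (Fin n → ℝ)) ⁻¹'
      (Set.univ.pi fun i => Set.Ico (z i * s) ((z i + 1) * s)) := by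
  ext x
  simp only [cube, idx, Set.mem_setOf_eq, Set.mem_preimage, Set.mem_univ_pi, Set.mem_Ico,
    funext_iff, Int.floor_eq_iff, le_div_iff₀ hs, div_lt_iff₀ hs]

lemma measurableSet_cube {n : ℕ} {s : ℝ} (hs : 0 < s) (z : Fin n → ℤ) :
    MeasurableSet (cube s z) := by
  rw [cube_eq hs]
  exact (PiLp.volume_preserving_ofLp (Fin n)).measurable
    (MeasurableSet.univ_pi fun i => measurableSet_Ico)

lemma volume_cube {n : ℕ} {s : ℝ} (hs : 0 < s) (z : Fin n → ℤ) :
    volume (cube s z) = ENNReal.ofReal (s ^ n) := by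
  rw [cube_eq hs, (PiLp.volume_preserving_ofLp (Fin n)).measure_preimage
    (MeasurableSet.univ_pi fun i => measurableSet_Ico).nullMeasurableSet, Real.volume_pi_Ico]
  rw [← ENNReal.ofReal_prod_of_nonneg (fun i _ => by nlinarith)]
  congr 1
  have : ∀ i, ((z i : ℝ) + 1) * s - z i * s = s := fun i => by ring
  simp [this]

lemma idx_half {n : ℕ} {s : ℝ} {x y : EuclideanSpace ℝ (Fin n)}
    (h : idx (s / 2) x = idx (s / 2) y) : idx s x = idx s y := by
  have key : ∀ w : EuclideanSpace ℝ (Fin n), ∀ i, idx s w i = idx (s / 2) w i / 2 := by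
    intro w i
    simp only [idx]
    have := Int.floor_div_natCast (w i / (s / 2)) 2
    push_cast at this
    rw [← this]
    congr 1
    by_cases hs : s = 0
    · simp [hs]
    · field_simp
  ext i
  rw [key x, key y, h]

lemma idx_mono {n : ℕ} {L : ℝ} {x y : EuclideanSpace ℝ (Fin n)} {i j : ℕ} (hij : i ≤ j)
    (h : idx (L / 2 ^ j) x = idx (L / 2 ^ j) y) : idx (L / 2 ^ i) x = idx (L / 2 ^ i) y := by
  induction j, hij using Nat.le_induction with
  | base => exact h
  | succ j hj ih =>
    apply ih
    apply idx_half
    rwa [pow_succ, ← div_div] at h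

lemma dist_le_of_mem_cube {n : ℕ} {s : ℝ} (hs : 0 < s) {x y : EuclideanSpace ℝ (Fin n)}
    (h : idx s x = idx s y) : ‖x - y‖ ≤ √n * s := by
  rw [EuclideanSpace.norm_eq]
  have : ∀ i, ‖(x - y) i‖ ^ 2 ≤ s ^ 2 := by
    intro i
    have h1 := congrFun h i
    simp only [idx] at h1
    have h2 := Int.abs_sub_lt_one_of_floor_eq_floor h1
    rw [← sub_div, abs_div, abs_of_pos hs, div_lt_one hs] at h2
    have : ‖(x - y) i‖ ≤ s := by simpa using h2.le
    gcongr
  calc √(∑ i, ‖(x - y) i‖ ^ 2) ≤ √(∑ i : Fin n, s ^ 2) := by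
        apply Real.sqrt_le_sqrt
        exact Finset.sum_le_sum fun i _ => this i
    _ = √n * s := by
        simp [Real.sqrt_sq hs.le]

lemma finite_idx {n : ℕ} {s : ℝ} (hs : 0 < s) {A : Set (EuclideanSpace ℝ (Fin n))} {R : ℝ}
    (hA : ∀ x ∈ A, ‖x‖ ≤ R) : (Set.image (idx s) A).Finite := by
  apply (Set.finite_Icc (fun _ : Fin n => ⌊-R / s⌋) (fun _ => ⌊R / s⌋)).subset
  rintro _ ⟨x, hx, rfl⟩
  have h : ∀ i, |x i| ≤ R := fun i => by
    have := PiLp.norm_apply_le x i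
    exact (this.trans (hA x hx))
  constructor
  · intro i
    apply Int.floor_le_floor
    gcongr
    exact (abs_le.1 (h i)).1
  · intro i
    apply Int.floor_le_floor
    gcongr
    exact (abs_le.1 (h i)).2

end CZ

namespace CZ
open scoped ENNReal NNReal

def DD (n : ℕ) : ℝ≥0∞ :=
  ENNReal.ofReal ((2 * √n) ^ n) * volume (Metric.ball (0 : EuclideanSpace ℝ (Fin n)) 1)

lemma DD_ne_top (n : ℕ) : DD n ≠ ⊤ :=
  ENNReal.mul_ne_top ENNReal.ofReal_ne_top measure_ball_lt_top.ne

lemma volume_ball_cube {n : ℕ} {s : ℝ} (hs : 0 < s) (hn : 1 ≤ n) (z : Fin n → ℤ)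
    (c : EuclideanSpace ℝ (Fin n)) :
    volume (Metric.ball c (2 * (√n * s))) ≤ DD n * volume (cube s z) := by
  rw [volume_cube hs, Measure.addHaar_ball_of_pos _ _ (by positivity), DD, mul_right_comm,
    ← ENNReal.ofReal_mul (by positivity), finrank_euclideanSpace, Fintype.card_fin]
  apply le_of_eq
  congr 2
  ring

theorem cz_decomp {n : ℕ} (hn : 1 ≤ n) (f : EuclideanSpace ℝ (Fin n) → ℂ) (hf : Continuous f)
    (hc : HasCompactSupport f) (l : ℝ≥0∞) (hl : 0 < l) (hl' : l ≠ ⊤) :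
    ∃ (S : Finset (ℕ × (Fin n → ℤ))) (Q : ℕ × (Fin n → ℤ) → Set (EuclideanSpace ℝ (Fin n)))
      (c : ℕ × (Fin n → ℤ) → EuclideanSpace ℝ (Fin n)) (r : ℕ × (Fin n → ℤ) → ℝ),
      (∀ i ∈ S, MeasurableSet (Q i)) ∧
      (∀ i ∈ S, ∀ j ∈ S, i ≠ j → Disjoint (Q i) (Q j)) ∧
      (∀ i ∈ S, 0 < r i ∧ ∀ y ∈ Q i, ‖y - c i‖ ≤ r i) ∧
      (∀ i ∈ S, volume (Metric.ball (c i) (2 * r i)) ≤ DD n * volume (Q i)) ∧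
      (∀ i ∈ S, volume (Q i) ≠ 0 ∧ volume (Q i) ≠ ⊤) ∧
      (∀ i ∈ S, l * volume (Q i) ≤ ∫⁻ x in Q i, ‖f x‖ₑ) ∧
      (∀ i ∈ S, ∫⁻ x in Q i, ‖f x‖ₑ ≤ 2 ^ n * l * volume (Q i)) ∧
      (∀ x, (∀ i ∈ S, x ∉ Q i) → ‖f x‖ₑ ≤ 2 * l) := by
  classical
  have hfint : Integrable f := hf.integrable_of_hasCompactSupport hc
  have hI : ∫⁻ x, ‖f x‖ₑ ≠ ⊤ := hfint.2.ne
  -- the large side length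
  obtain ⟨L, hL, hLI⟩ : ∃ L : ℝ, 0 < L ∧ ∫⁻ x, ‖f x‖ₑ ≤ l * ENNReal.ofReal (L ^ n) := by
    refine ⟨max 1 ((∫⁻ x, ‖f x‖ₑ) / l).toReal, by positivity, ?_⟩
    have h1 : (∫⁻ x, ‖f x‖ₑ) / l ≠ ⊤ := ENNReal.div_ne_top hI hl.ne'
    calc ∫⁻ x, ‖f x‖ₑ = l * ((∫⁻ x, ‖f x‖ₑ) / l) := (ENNReal.mul_div_cancel hl.ne' hl').symm
      _ = l * ENNReal.ofReal ((∫⁻ x, ‖f x‖ₑ) / l).toReal := by rw [ENNReal.ofReal_toReal h1]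
      _ ≤ _ := by
        gcongr
        refine (le_max_right 1 _).trans (le_self_pow₀ (le_max_left _ _) (by omega))
  -- the small scale
  obtain ⟨b, hb⟩ : ∃ b : ℕ, ∀ x y, idx (L / 2 ^ b) x = idx (L / 2 ^ b) y →
      ‖f x - f y‖ₑ ≤ l := by
    have huc := hf.uniformContinuous_of_tendsto_cocompact (hc.is_zero_at_infty)
    rw [Metric.uniformContinuous_iff] at huc
    obtain ⟨δ, hδ, h⟩ := huc l.toReal (ENNReal.toReal_pos hl.ne' hl')
    obtain ⟨b, hb⟩ := exists_nat_gt (√n * L / δ)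
    refine ⟨b, fun x y hxy => ?_⟩
    have h2 : (b : ℝ) < 2 ^ b := by exact_mod_cast Nat.lt_two_pow_self
    have h3 : ‖x - y‖ < δ := by
      refine (dist_le_of_mem_cube (by positivity) hxy).trans_lt ?_
      rw [div_lt_iff₀ hδ] at hb
      rw [← mul_div_assoc, div_lt_iff₀ (by positivity)]
      nlinarith
    have h4 := h (dist_eq_norm x y ▸ h3)
    rw [dist_eq_norm] at h4
    rw [← ofReal_norm_eq_enorm, ← ENNReal.ofReal_toReal hl']
    exact ENNReal.ofReal_le_ofReal h4.le
  set sd : ℕ → ℝ := fun j => L / 2 ^ j with hsd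
  have hsd0 : ∀ j, 0 < sd j := fun j => by positivity
  let bad : ℕ → (Fin n → ℤ) → Prop := fun j z =>
    l * volume (cube (sd j) z) < ∫⁻ x in cube (sd j) z, ‖f x‖ₑ
  let sel : ℕ → (Fin n → ℤ) → Prop := fun j z =>
    bad j z ∧ ∀ i < j, ∀ x ∈ cube (sd j) z, ¬ bad i (idx (sd i) x)
  have hbad_ex : ∀ j z, bad j z → ∃ x, idx (sd j) x = z ∧ f x ≠ 0 := by
    intro j z hz
    by_contra! hcon
    have : ∫⁻ x in cube (sd j) z, ‖f x‖ₑ = 0 := by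
      rw [setLIntegral_congr_fun (g := fun _ => 0) (measurableSet_cube (hsd0 j) z)
        (fun x hx => by simp [hcon x hx])]
      simp
    simp only [bad, this] at hz
    exact not_lt_zero hz
  have hbad0 : ∀ z, ¬ bad 0 z := by
    intro z hz
    refine absurd hz (not_lt.2 ?_)
    rw [volume_cube (hsd0 0)]
    simp only [hsd, pow_zero, div_one]
    exact (setLIntegral_le_lintegral _ _).trans hLI
  obtain ⟨R, hR⟩ := hc.isCompact.isBounded.exists_norm_le
  have hfin : {q : ℕ × (Fin n → ℤ) | q.1 ≤ b ∧ sel q.1 q.2}.Finite := by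
    apply Set.Finite.subset (s := ⋃ j ∈ Finset.range (b + 1),
      Set.image (fun z => (j, z)) (Set.image (idx (sd j)) (tsupport f)))
    · apply Set.Finite.biUnion (Finset.finite_toSet _)
      intro j _
      exact (finite_idx (hsd0 j) hR).image _
    · rintro ⟨j, z⟩ ⟨h1, h2, -⟩
      obtain ⟨x, hx, hx'⟩ := hbad_ex j z h2
      simp only [Set.mem_iUnion]
      exact ⟨j, by simpa [Nat.lt_succ_iff] using h1, z, ⟨x, subset_tsupport f hx', hx⟩, rfl⟩
  have hS : ∀ q, q ∈ hfin.toFinset ↔ q.1 ≤ b ∧ sel q.1 q.2 := fun q => by simp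
  have hcen : ∀ q : ℕ × (Fin n → ℤ), ∃ c, q ∈ hfin.toFinset → idx (sd q.1) c = q.2 := by
    intro q
    by_cases hq : q ∈ hfin.toFinset
    · obtain ⟨x, hx, -⟩ := hbad_ex _ _ ((hS q).1 hq).2.1
      exact ⟨x, fun _ => hx⟩
    · exact ⟨0, fun h => absurd h hq⟩
  choose c hcc using hcen
  refine ⟨hfin.toFinset, fun q => cube (sd q.1) q.2, c, fun q => √n * sd q.1,
    fun q _ => measurableSet_cube (hsd0 _) _, ?_, ?_, ?_, ?_, ?_, ?_, ?_⟩
  · rintro ⟨j, z⟩ hj ⟨j', z'⟩ hj' hne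
    rw [Set.disjoint_left]
    intro x hx hx'
    have h1 := ((hS _).1 hj).2
    have h2 := ((hS _).1 hj').2
    simp only at h1 h2 hx hx'
    rcases lt_trichotomy j j' with h | h | h
    · apply h2.2 j h x hx'
      have : idx (sd j) x = z := hx
      rw [this]; exact h1.1
    · subst h
      apply hne
      have e1 : idx (sd j) x = z := hx
      have e2 : idx (sd j) x = z' := hx'
      rw [← e1, ← e2]
    · apply h1.2 j' h x hx
      have : idx (sd j') x = z' := hx'
      rw [this]; exact h2.1
  · intro q hq
    have : (0 : ℝ) < n := by exact_mod_cast hn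
    refine ⟨by have := hsd0 q.1; positivity, fun y hy => dist_le_of_mem_cube (hsd0 _) ?_⟩
    rw [hcc q hq]; exact hy
  · intro q _
    exact volume_ball_cube (hsd0 _) hn _ _
  · intro q _
    simp only [volume_cube (hsd0 q.1)]
    exact ⟨by simpa using pow_pos (hsd0 q.1) n, ENNReal.ofReal_ne_top⟩
  · intro q hq
    exact (((hS q).1 hq).2.1).le
  · rintro ⟨j, z⟩ hq
    have h1 := ((hS _).1 hq).2
    have hx := hcc _ hq
    set x := c (j, z)
    simp only at h1 hx ⊢
    rcases j with _ | j
    · exact absurd h1.1 (hbad0 z)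
    · have h2 := h1.2 j (by omega) x hx
      have hsub : cube (sd (j + 1)) z ⊆ cube (sd j) (idx (sd j) x) := by
        intro y hy
        have e : idx (sd (j + 1)) y = idx (sd (j + 1)) x := by rw [hx]; exact hy
        exact idx_mono (Nat.le_succ j) e
      refine (lintegral_mono_set hsub).trans ((not_lt.1 h2).trans ?_)
      rw [volume_cube (hsd0 _), volume_cube (hsd0 _), mul_comm (2 ^ n) l, mul_assoc]
      gcongr
      rw [show (2 : ℝ≥0∞) ^ n = ENNReal.ofReal (2 ^ n) by
        rw [ENNReal.ofReal_pow (by norm_num)]; norm_num, ← ENNReal.ofReal_mul (by positivity),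
        ← mul_pow]
      apply le_of_eq
      congr 2
      simp only [hsd, pow_succ]
      field_simp
  · intro x hx
    have hnb : ∀ j, j ≤ b → ¬ bad j (idx (sd j) x) := by
      intro j
      induction j using Nat.strong_induction_on with
      | _ j ih =>
        intro hj hbadj
        apply hx (j, idx (sd j) x) ((hS _).2 ⟨hj, hbadj, fun i hi y hy => ?_⟩) rfl
        rw [show idx (sd i) y = idx (sd i) x from idx_mono hi.le hy]
        exact ih i hi (by omega)
    have h1 := not_lt.1 (hnb b le_rfl)
    set Qx := cube (sd b) (idx (sd b) x)
    have hv0 : volume Qx ≠ 0 := by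
      rw [volume_cube (hsd0 b)]; simpa using pow_pos (hsd0 b) n
    have hvt : volume Qx ≠ ⊤ := by
      rw [volume_cube (hsd0 b)]; exact ENNReal.ofReal_ne_top
    have h2 : ‖f x‖ₑ * volume Qx ≤ 2 * l * volume Qx := by
      calc ‖f x‖ₑ * volume Qx = ∫⁻ y in Qx, ‖f x‖ₑ := by simp
        _ ≤ ∫⁻ y in Qx, (‖f y‖ₑ + l) := by
          apply setLIntegral_mono' (measurableSet_cube (hsd0 b) _)
          intro y hy
          have := hb x y (show idx (sd b) x = idx (sd b) y from (hy : idx (sd b) y = _).symm)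
          calc ‖f x‖ₑ = ‖f y + (f x - f y)‖ₑ := by congr 1; ring
            _ ≤ ‖f y‖ₑ + ‖f x - f y‖ₑ := enorm_add_le _ _
            _ ≤ _ := by gcongr
        _ = (∫⁻ y in Qx, ‖f y‖ₑ) + l * volume Qx := by
          rw [lintegral_add_right _ measurable_const]; simp
        _ ≤ l * volume Qx + l * volume Qx := by gcongr
        _ = _ := by ring
    exact (ENNReal.mul_le_mul_iff_left hv0 hvt).1 h2

end CZ

namespace CZ
open scoped ENNReal NNReal

/-- convolution operator -/
def T {n : ℕ} (K f : EuclideanSpace ℝ (Fin n) → ℂ) (x : EuclideanSpace ℝ (Fin n)) : ℂ :=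
  ∫ y, K (x - y) * f y

structure IsCZ {n : ℕ} (K : EuclideanSpace ℝ (Fin n) → ℂ) (B : ℝ≥0∞) : Prop where
  cont : Continuous K
  bdd : ∃ M : ℝ, ∀ x, ‖K x‖ ≤ M
  l2 : ∀ f : EuclideanSpace ℝ (Fin n) → ℂ, Integrable f → MemLp f 2 →
    ∫⁻ x, ‖T K f x‖ₑ ^ 2 ≤ B * ∫⁻ x, ‖f x‖ₑ ^ 2
  hor : ∀ y, ∫⁻ x in {x | 2 * ‖y‖ ≤ ‖x‖}, ‖K (x - y) - K x‖ₑ ≤ B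

variable {n : ℕ} {K : EuclideanSpace ℝ (Fin n) → ℂ} {B : ℝ≥0∞}

lemma integrable_T (h : IsCZ K B) {f : EuclideanSpace ℝ (Fin n) → ℂ} (hf : Integrable f)
    (x : EuclideanSpace ℝ (Fin n)) : Integrable fun y => K (x - y) * f y := by
  obtain ⟨M, hM⟩ := h.bdd
  have hc := h.cont
  refine hf.bdd_mul (c := M) ?_ (Filter.Eventually.of_forall fun y => hM _)
  exact (by fun_prop : Continuous fun y => K (x - y)).aestronglyMeasurable

lemma continuous_T (h : IsCZ K B) {f : EuclideanSpace ℝ (Fin n) → ℂ} (hf : Integrable f) :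
    Continuous (T K f) := by
  obtain ⟨M, hM⟩ := h.bdd
  have hc := h.cont
  refine continuous_of_dominated (bound := fun y => M * ‖f y‖) ?_ ?_ ?_ ?_
  · exact fun x => (integrable_T h hf x).aestronglyMeasurable
  · intro x
    refine Filter.Eventually.of_forall fun y => ?_
    rw [norm_mul]
    gcongr
    exact hM _
  · exact hf.norm.const_mul M
  · refine Filter.Eventually.of_forall fun y => ?_
    fun_prop

lemma T_bad (h : IsCZ K B) {b : EuclideanSpace ℝ (Fin n) → ℂ} (hb : Integrable b)
    (hb0 : ∫ y, b y = 0) (c : EuclideanSpace ℝ (Fin n)) (r : ℝ)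
    (hQ : ∀ y, b y ≠ 0 → ‖y - c‖ ≤ r) :
    ∫⁻ x in (Metric.ball c (2 * r))ᶜ, ‖T K b x‖ₑ ≤ B * ∫⁻ y, ‖b y‖ₑ := by
  have hK := h.cont
  have h1 : ∀ x, ‖T K b x‖ₑ ≤ ∫⁻ y, ‖K (x - y) - K (x - c)‖ₑ * ‖b y‖ₑ := by
    intro x
    have : T K b x = ∫ y, (K (x - y) - K (x - c)) * b y := by
      simp_rw [sub_mul]
      rw [integral_sub (integrable_T h hb x) (hb.const_mul _), integral_const_mul, hb0]
      simp [T]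
    rw [this]
    refine (enorm_integral_le_lintegral_enorm _).trans (le_of_eq ?_)
    simp_rw [enorm_mul]
  have hm : AEMeasurable (Function.uncurry fun x y => ‖K (x - y) - K (x - c)‖ₑ * ‖b y‖ₑ)
      ((volume.restrict (Metric.ball c (2 * r))ᶜ).prod volume) := by
    refine AEMeasurable.mul (f := fun p : EuclideanSpace ℝ (Fin n) × EuclideanSpace ℝ (Fin n) =>
      ‖K (p.1 - p.2) - K (p.1 - c)‖ₑ) (g := fun p => ‖b p.2‖ₑ) ?_ ?_
    · apply Measurable.aemeasurable
      exact (by fun_prop : Continuous fun p : EuclideanSpace ℝ (Fin n) × EuclideanSpace ℝ (Fin n) =>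
        K (p.1 - p.2) - K (p.1 - c)).enorm.measurable
    · exact (hb.aestronglyMeasurable.comp_snd).enorm
  calc ∫⁻ x in (Metric.ball c (2 * r))ᶜ, ‖T K b x‖ₑ
      ≤ ∫⁻ x in (Metric.ball c (2 * r))ᶜ, ∫⁻ y, ‖K (x - y) - K (x - c)‖ₑ * ‖b y‖ₑ :=
        lintegral_mono fun x => h1 x
    _ = ∫⁻ y, ∫⁻ x in (Metric.ball c (2 * r))ᶜ, ‖K (x - y) - K (x - c)‖ₑ * ‖b y‖ₑ :=
        lintegral_lintegral_swap hm
    _ ≤ ∫⁻ y, B * ‖b y‖ₑ := by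
        apply lintegral_mono
        intro y
        simp only
        by_cases hy : b y = 0
        · simp [hy]
        rw [lintegral_mul_const' _ _ enorm_ne_top]
        gcongr
        have hyr := hQ y hy
        calc ∫⁻ x in (Metric.ball c (2 * r))ᶜ, ‖K (x - y) - K (x - c)‖ₑ
            = ∫⁻ x, (Metric.ball c (2 * r))ᶜ.indicator
                (fun x => ‖K (x - y) - K (x - c)‖ₑ) x :=
              (lintegral_indicator Metric.isOpen_ball.measurableSet.compl _).symm
          _ = ∫⁻ x, (Metric.ball c (2 * r))ᶜ.indicator
                (fun x => ‖K (x - y) - K (x - c)‖ₑ) (x + c) :=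
              (lintegral_add_right_eq_self _ c).symm
          _ ≤ ∫⁻ x, {x | 2 * ‖y - c‖ ≤ ‖x‖}.indicator
                (fun x => ‖K (x - (y - c)) - K x‖ₑ) x := by
              apply lintegral_mono
              intro x
              by_cases hx : x + c ∈ Metric.ball c (2 * r)
              · simp [Set.indicator_of_notMem, hx]
              · beta_reduce
                rw [Set.indicator_of_mem (s := (Metric.ball c (2 * r))ᶜ) hx,
                  Set.indicator_of_mem]
                · simp [sub_sub_eq_add_sub]
                · simp at hx ⊢
                  linarith
          _ = ∫⁻ x in {x | 2 * ‖y - c‖ ≤ ‖x‖}, ‖K (x - (y - c)) - K x‖ₑ := by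
              apply lintegral_indicator
              exact (isClosed_le (by fun_prop) (by fun_prop)).measurableSet
          _ ≤ B := h.hor _
    _ = B * ∫⁻ y, ‖b y‖ₑ := lintegral_const_mul'' _ hb.aestronglyMeasurable.enorm

def CW (n : ℕ) (B : ℝ≥0∞) : ℝ≥0∞ := B * ((2 ^ n + 2) * 3) + DD n + 2 * B

lemma CW_ne_top (hB : B ≠ ⊤) : CW n B ≠ ⊤ := by
  unfold CW
  have := DD_ne_top n
  finiteness

theorem weak11 (hn : 1 ≤ n) (h : IsCZ K B) {f : EuclideanSpace ℝ (Fin n) → ℂ} (hf : Continuous f)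
    (hc : HasCompactSupport f) (l : ℝ≥0∞) (hl : 0 < l) (hl' : l ≠ ⊤) :
    volume {x | 2 * l < ‖T K f x‖ₑ} ≤ CW n B * (l⁻¹ * ∫⁻ x, ‖f x‖ₑ) := by
  classical
  obtain ⟨S, Q, c, r, hQm, hdisj, hr, hball, hvol, hlow, hup, hout⟩ := cz_decomp hn f hf hc l hl hl'
  have hfi : Integrable f := hf.integrable_of_hasCompactSupport hc
  have hf2 : MemLp f 2 := hf.memLp_of_hasCompactSupport hc
  let avg : ℕ × (Fin n → ℤ) → ℂ := fun i => ⨍ x in Q i, f x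
  let b : ℕ × (Fin n → ℤ) → EuclideanSpace ℝ (Fin n) → ℂ := fun i =>
    (Q i).indicator (fun x => f x - avg i)
  have hb_eq : ∀ i, b i = (Q i).indicator f - (Q i).indicator (fun _ => avg i) := fun i => by
    ext x; simp only [b, Set.indicator, Pi.sub_apply]; split_ifs <;> simp
  have hbi : ∀ i ∈ S, Integrable (b i) := fun i hi => by
    rw [hb_eq]
    exact (hfi.indicator (hQm i hi)).sub
      ((integrableOn_const (hvol i hi).2).integrable_indicator (hQm i hi))
  have hb2 : ∀ i ∈ S, MemLp (b i) 2 := fun i hi => by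
    rw [hb_eq]
    exact (hf2.indicator (hQm i hi)).sub
      (memLp_indicator_const 2 (hQm i hi) (avg i) (Or.inr (hvol i hi).2))
  let g : EuclideanSpace ℝ (Fin n) → ℂ := f - ∑ i ∈ S, b i
  have hgi : Integrable g := hfi.sub (integrable_finsetSum' S hbi)
  have hg2 : MemLp g 2 := hf2.sub (memLp_finsetSum' S hb2)
  -- averages
  have havg : ∀ i ∈ S, ‖avg i‖ₑ * volume (Q i) ≤ ∫⁻ x in Q i, ‖f x‖ₑ := by
    intro i hi
    have h1 : avg i * ((volume (Q i)).toReal : ℂ) = ∫ x in Q i, f x := by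
      have : (volume.real (Q i) : ℂ) ≠ 0 := by
        rw [Measure.real]
        exact_mod_cast (ENNReal.toReal_pos (hvol i hi).1 (hvol i hi).2).ne'
      simp only [avg, setAverage_eq, Complex.real_smul, Complex.ofReal_inv]
      rw [Measure.real] at *
      field_simp
    have h2 : ‖((volume (Q i)).toReal : ℂ)‖ₑ = volume (Q i) := by
      rw [← ofReal_norm, Complex.norm_real, Real.norm_of_nonneg ENNReal.toReal_nonneg,
        ENNReal.ofReal_toReal (hvol i hi).2]
    rw [← h2, ← enorm_mul, h1]
    exact enorm_integral_le_lintegral_enorm _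
  have hb0 : ∀ i ∈ S, ∫ y, b i y = 0 := by
    intro i hi
    have hv : IsFiniteMeasure (volume.restrict (Q i)) :=
      ⟨by simpa using (hvol i hi).2.lt_top⟩
    rw [integral_indicator (hQm i hi)]
    exact integral_sub_average _ _
  have hb1 : ∀ i ∈ S, ∫⁻ x, ‖b i x‖ₑ ≤ 2 * ∫⁻ x in Q i, ‖f x‖ₑ := by
    intro i hi
    have : ∀ x, ‖b i x‖ₑ = (Q i).indicator (fun x => ‖f x - avg i‖ₑ) x := fun x => by
      simp only [b, Set.indicator]; split_ifs <;> simp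
    simp_rw [this]
    rw [lintegral_indicator (hQm i hi)]
    calc ∫⁻ x in Q i, ‖f x - avg i‖ₑ ≤ ∫⁻ x in Q i, (‖f x‖ₑ + ‖avg i‖ₑ) :=
          lintegral_mono fun x => enorm_sub_le
      _ = (∫⁻ x in Q i, ‖f x‖ₑ) + ‖avg i‖ₑ * volume (Q i) := by
          rw [lintegral_add_right _ measurable_const]; simp
      _ ≤ _ := by rw [two_mul]; gcongr; exact havg i hi
  have hsum : ∑ i ∈ S, ∫⁻ x in Q i, ‖f x‖ₑ ≤ ∫⁻ x, ‖f x‖ₑ := by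
    rw [← lintegral_biUnion_finset (fun i hi j hj hij => hdisj i hi j hj hij) hQm]
    exact setLIntegral_le_lintegral _ _
  have hsumb : ∑ i ∈ S, ∫⁻ x, ‖b i x‖ₑ ≤ 2 * ∫⁻ x, ‖f x‖ₑ := by
    refine (Finset.sum_le_sum hb1).trans ?_
    rw [← Finset.mul_sum]
    gcongr
  -- good part
  have hg_bd : ∀ x, ‖g x‖ₑ ≤ (2 ^ n + 2) * l := by
    intro x
    by_cases hx : ∃ i ∈ S, x ∈ Q i
    · obtain ⟨i, hi, hxi⟩ := hx
      have : g x = avg i := by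
        simp only [g, Pi.sub_apply, Finset.sum_apply]
        rw [Finset.sum_eq_single_of_mem i hi]
        · simp [b, hxi]
        · intro j hj hji
          have : x ∉ Q j := fun hxj => Set.disjoint_left.1 (hdisj j hj i hi hji) hxj hxi
          simp [b, this]
      rw [this]
      refine le_trans ?_ (mul_le_mul_left (le_self_add : (2 : ℝ≥0∞) ^ n ≤ 2 ^ n + 2) l)
      exact (ENNReal.mul_le_mul_iff_left (hvol i hi).1 (hvol i hi).2).1
        ((havg i hi).trans (hup i hi))
    · push Not at hx
      have : g x = f x := by
        simp only [g, Pi.sub_apply, Finset.sum_apply]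
        rw [Finset.sum_eq_zero fun i hi => by simp [b, hx i hi]]
        simp
      rw [this]
      exact (hout x hx).trans (mul_le_mul_left le_add_self l)
  have hg1 : ∫⁻ x, ‖g x‖ₑ ≤ 3 * ∫⁻ x, ‖f x‖ₑ := by
    calc ∫⁻ x, ‖g x‖ₑ ≤ ∫⁻ x, (‖f x‖ₑ + ∑ i ∈ S, ‖b i x‖ₑ) := by
          apply lintegral_mono
          intro x
          simp only [g, Pi.sub_apply, Finset.sum_apply]
          refine enorm_sub_le.trans ?_
          gcongr
          exact enorm_sum_le _ _
      _ = (∫⁻ x, ‖f x‖ₑ) + ∑ i ∈ S, ∫⁻ x, ‖b i x‖ₑ := by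
          rw [lintegral_add_left' hfi.aestronglyMeasurable.enorm,
            lintegral_finsetSum' S fun i hi => (hbi i hi).aestronglyMeasurable.enorm]
      _ ≤ (∫⁻ x, ‖f x‖ₑ) + 2 * ∫⁻ x, ‖f x‖ₑ := by gcongr
      _ = _ := by ring
  have hgsq : ∫⁻ x, ‖g x‖ₑ ^ 2 ≤ (2 ^ n + 2) * l * (3 * ∫⁻ x, ‖f x‖ₑ) := by
    calc ∫⁻ x, ‖g x‖ₑ ^ 2 ≤ ∫⁻ x, (2 ^ n + 2) * l * ‖g x‖ₑ := by
          apply lintegral_mono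
          intro x
          simp only [sq]
          gcongr
          exact hg_bd x
      _ = (2 ^ n + 2) * l * ∫⁻ x, ‖g x‖ₑ := lintegral_const_mul'' _ hgi.aestronglyMeasurable.enorm
      _ ≤ _ := by gcongr
  have hTsum : ∀ x, T K f x = T K g x + ∑ i ∈ S, T K (b i) x := by
    intro x
    simp only [T]
    rw [← integral_finsetSum S fun i hi => integrable_T h (hbi i hi) x,
      ← integral_add (integrable_T h hgi x)
        (integrable_finsetSum S fun i hi => integrable_T h (hbi i hi) x)]
    congr 1
    ext y
    simp only [g, Pi.sub_apply, Finset.sum_apply, ← Finset.mul_sum]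
    ring
  set U : Set (EuclideanSpace ℝ (Fin n)) := ⋃ i ∈ S, Metric.ball (c i) (2 * r i) with hU
  have hUm : MeasurableSet U := Finset.measurableSet_biUnion S fun i _ =>
    Metric.isOpen_ball.measurableSet
  have hincl : {x | 2 * l < ‖T K f x‖ₑ} ⊆ {x | l ^ 2 ≤ ‖T K g x‖ₑ ^ 2} ∪ U ∪
      {x | l ≤ Uᶜ.indicator (fun x => ∑ i ∈ S, ‖T K (b i) x‖ₑ) x} := by
    intro x hx
    simp only [Set.mem_setOf_eq] at hx
    by_contra hcon
    simp only [Set.mem_union, Set.mem_setOf_eq, not_or, not_le] at hcon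
    obtain ⟨⟨h1, h2⟩, h3⟩ := hcon
    rw [Set.indicator_of_mem (by simpa using h2)] at h3
    have h1' : ‖T K g x‖ₑ < l := lt_of_not_ge fun hh => absurd h1 (not_lt.2 (pow_le_pow_left' hh 2))
    refine absurd hx (not_lt.2 ?_)
    rw [hTsum, two_mul]
    refine (enorm_add_le _ _).trans ?_
    gcongr
    exact (enorm_sum_le _ _).trans h3.le
  have hlinv : l⁻¹ ≠ ⊤ := ENNReal.inv_ne_top.2 hl.ne'
  have m1 : volume {x | l ^ 2 ≤ ‖T K g x‖ₑ ^ 2} ≤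
      B * ((2 ^ n + 2) * 3) * (l⁻¹ * ∫⁻ x, ‖f x‖ₑ) := by
    refine (meas_ge_le_lintegral_div
      (((continuous_T h hgi).enorm.measurable.pow_const 2).aemeasurable) (by positivity)
      (by finiteness)).trans ?_
    rw [ENNReal.div_eq_inv_mul]
    calc (l ^ 2)⁻¹ * ∫⁻ x, ‖T K g x‖ₑ ^ 2
        ≤ (l ^ 2)⁻¹ * (B * ((2 ^ n + 2) * l * (3 * ∫⁻ x, ‖f x‖ₑ))) := by
          gcongr
          exact (h.l2 g hgi hg2).trans (by gcongr)
      _ = B * ((2 ^ n + 2) * 3) * (l⁻¹ * (l⁻¹ * l) * ∫⁻ x, ‖f x‖ₑ) := by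
          rw [ENNReal.inv_pow]; ring
      _ = _ := by rw [ENNReal.inv_mul_cancel hl.ne' hl', mul_one]
  have m2 : volume U ≤ DD n * (l⁻¹ * ∫⁻ x, ‖f x‖ₑ) := by
    calc volume U ≤ ∑ i ∈ S, volume (Metric.ball (c i) (2 * r i)) := measure_biUnion_finset_le _ _
      _ ≤ ∑ i ∈ S, DD n * (l⁻¹ * ∫⁻ x in Q i, ‖f x‖ₑ) := by
          apply Finset.sum_le_sum
          intro i hi
          refine (hball i hi).trans ?_
          gcongr
          rw [← ENNReal.div_eq_inv_mul, ENNReal.le_div_iff_mul_le (Or.inl hl.ne') (Or.inl hl'),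
            mul_comm]
          exact hlow i hi
      _ ≤ _ := by
          rw [← Finset.mul_sum, ← Finset.mul_sum]
          gcongr
  have m3 : volume {x | l ≤ Uᶜ.indicator (fun x => ∑ i ∈ S, ‖T K (b i) x‖ₑ) x} ≤
      2 * B * (l⁻¹ * ∫⁻ x, ‖f x‖ₑ) := by
    have hms : ∀ i ∈ S, Measurable fun x => ‖T K (b i) x‖ₑ := fun i hi =>
      (continuous_T h (hbi i hi)).enorm.measurable
    refine (meas_ge_le_lintegral_div
      (((Finset.measurable_fun_sum S hms).indicator hUm.compl).aemeasurable) hl.ne' hl').trans ?_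
    rw [ENNReal.div_eq_inv_mul, lintegral_indicator hUm.compl, lintegral_finsetSum' S
      fun i hi => (hms i hi).aemeasurable]
    calc l⁻¹ * ∑ i ∈ S, ∫⁻ x in Uᶜ, ‖T K (b i) x‖ₑ
        ≤ l⁻¹ * ∑ i ∈ S, B * ∫⁻ x, ‖b i x‖ₑ := by
          gcongr with i hi
          refine (lintegral_mono_set (Set.compl_subset_compl.2 ?_)).trans
            (T_bad h (hbi i hi) (hb0 i hi) (c i) (r i) ?_)
          · exact Set.subset_biUnion_of_mem (u := fun i => Metric.ball (c i) (2 * r i)) hi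
          · intro y hy
            apply (hr i hi).2
            by_contra hcon
            exact hy (by simp [b, hcon])
      _ ≤ l⁻¹ * (B * (2 * ∫⁻ x, ‖f x‖ₑ)) := by
          rw [← Finset.mul_sum]; gcongr
      _ = _ := by ring
  refine (measure_mono hincl).trans ((measure_union_le _ _).trans
    ((add_le_add_left (measure_union_le _ _) _).trans ?_))
  rw [CW, add_mul, add_mul]
  gcongr

end CZ

namespace CZ
open scoped ENNReal NNReal

variable {n : ℕ} {K : EuclideanSpace ℝ (Fin n) → ℂ} {B : ℝ≥0∞}

lemma lint_rpow_Ioc {a s : ℝ} (ha : 0 < a) (hs : -1 < s) :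
    ∫⁻ t in Set.Ioc 0 a, ENNReal.ofReal (t ^ s) = ENNReal.ofReal (a ^ (s + 1) / (s + 1)) := by
  rw [← ofReal_integral_eq_lintegral_ofReal]
  · rw [← intervalIntegral.integral_of_le ha.le, integral_rpow (Or.inl hs), Real.zero_rpow (by linarith)]
    simp
  · exact (intervalIntegral.intervalIntegrable_rpow' hs).1
  · filter_upwards [ae_restrict_mem measurableSet_Ioc] with t ht
    exact Real.rpow_nonneg ht.1.le _

lemma lint_rpow_Ioi {a s : ℝ} (ha : 0 < a) (hs : s < -1) :
    ∫⁻ t in Set.Ioi a, ENNReal.ofReal (t ^ s) = ENNReal.ofReal (-a ^ (s + 1) / (s + 1)) := by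
  rw [← ofReal_integral_eq_lintegral_ofReal]
  · rw [integral_Ioi_rpow_of_lt hs ha]
  · exact integrableOn_Ioi_rpow_of_lt hs ha
  · filter_upwards [ae_restrict_mem measurableSet_Ioi] with t ht
    exact Real.rpow_nonneg (ha.trans ht).le _

def F1 (p t a : ℝ) : ℝ≥0∞ := ENNReal.ofReal (if t < a then a * t ^ (p - 2) else 0)
def F2 (p t a : ℝ) : ℝ≥0∞ := ENNReal.ofReal ((min a t) ^ 2 * t ^ (p - 3))

lemma F1_int {p a : ℝ} (hp : 1 < p) (ha : 0 ≤ a) :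
    ∫⁻ t in Set.Ioi 0, F1 p t a ≤ ENNReal.ofReal (1 / (p - 1)) * ENNReal.ofReal (a ^ p) := by
  rcases ha.eq_or_lt with rfl | ha
  · rw [setLIntegral_congr_fun (g := fun _ => 0) measurableSet_Ioi]
    · simp
    · intro t ht
      have : ¬ t < 0 := not_lt.2 (le_of_lt ht)
      simp [F1, this]
  calc ∫⁻ t in Set.Ioi 0, F1 p t a
      ≤ ∫⁻ t in Set.Ioi 0, (Set.Ioc 0 a).indicator
          (fun t => ENNReal.ofReal a * ENNReal.ofReal (t ^ (p - 2))) t := by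
        apply setLIntegral_mono' measurableSet_Ioi
        intro t ht
        unfold F1
        split_ifs with h
        · rw [Set.indicator_of_mem (s := Set.Ioc 0 a) ⟨ht, h.le⟩, ENNReal.ofReal_mul ha.le]
        · simp
    _ ≤ ∫⁻ t, (Set.Ioc 0 a).indicator
          (fun t => ENNReal.ofReal a * ENNReal.ofReal (t ^ (p - 2))) t :=
        setLIntegral_le_lintegral _ _
    _ = ENNReal.ofReal a * ENNReal.ofReal (a ^ (p - 2 + 1) / (p - 2 + 1)) := by
        rw [lintegral_indicator measurableSet_Ioc, lintegral_const_mul' _ _ ENNReal.ofReal_ne_top,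
          lint_rpow_Ioc ha (by linarith)]
    _ = _ := by
        rw [← ENNReal.ofReal_mul ha.le, ← ENNReal.ofReal_mul (by
          have : 0 < p - 1 := by linarith
          positivity)]
        congr 1
        have h1 : a ^ p = a * a ^ (p - 1) := by
          rw [Real.rpow_sub_one ha.ne']; field_simp
        rw [h1, show p - 2 + 1 = p - 1 by ring]
        ring

lemma F2_int {p a : ℝ} (hp : 1 < p) (hp2 : p < 2) (ha : 0 ≤ a) :
    ∫⁻ t in Set.Ioi 0, F2 p t a ≤
      ENNReal.ofReal (1 / p + 1 / (2 - p)) * ENNReal.ofReal (a ^ p) := by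
  rcases ha.eq_or_lt with rfl | ha
  · rw [setLIntegral_congr_fun (g := fun _ => 0) measurableSet_Ioi]
    · simp
    · intro t ht
      have : min 0 t = 0 := min_eq_left (le_of_lt ht)
      simp [F2, this]
  have hsplit : Set.Ioi (0 : ℝ) = Set.Ioc 0 a ∪ Set.Ioi a := (Set.Ioc_union_Ioi_eq_Ioi ha.le).symm
  rw [hsplit]
  refine (lintegral_union_le _ _ _).trans ?_
  have e1 : ∫⁻ t in Set.Ioc 0 a, F2 p t a = ENNReal.ofReal (a ^ p / p) := by
    rw [setLIntegral_congr_fun (g := fun t => ENNReal.ofReal (t ^ (p - 1))) measurableSet_Ioc]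
    · rw [lint_rpow_Ioc ha (by linarith)]; simp
    · intro t ht
      simp only [F2]
      rw [min_eq_right ht.2]
      congr 1
      rw [← Real.rpow_natCast, ← Real.rpow_add ht.1]
      congr 1; push_cast; ring
  have e2 : ∫⁻ t in Set.Ioi a, F2 p t a = ENNReal.ofReal (a ^ p / (2 - p)) := by
    rw [setLIntegral_congr_fun (g := fun t => ENNReal.ofReal (a ^ 2) * ENNReal.ofReal (t ^ (p - 3)))
      measurableSet_Ioi]
    · rw [lintegral_const_mul' _ _ ENNReal.ofReal_ne_top, lint_rpow_Ioi ha (by linarith),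
        ← ENNReal.ofReal_mul (by positivity)]
      congr 1
      have h1 : a ^ p = a ^ 2 * a ^ (p - 2) := by
        rw [← Real.rpow_natCast, ← Real.rpow_add ha]
        congr 1; push_cast; ring
      have h2 : 2 - p ≠ 0 := by linarith
      have h3 : p - 2 ≠ 0 := by intro h; apply h2; linarith
      rw [h1, show p - 3 + 1 = p - 2 by ring]
      field_simp
      ring
    · intro t ht
      simp only [F2]
      rw [min_eq_left (le_of_lt ht), ENNReal.ofReal_mul (by positivity)]
  rw [e1, e2, ← ENNReal.ofReal_add (by positivity) (by
    have : 0 < 2 - p := by linarith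
    positivity), ← ENNReal.ofReal_mul (by
    have : 0 < 2 - p := by linarith
    positivity)]
  apply le_of_eq
  congr 1
  ring

/-- truncation -/
def trunc (t : ℝ) (z : ℂ) : ℂ := ((t / max ‖z‖ t : ℝ) : ℂ) * z

lemma continuous_trunc {t : ℝ} (ht : 0 < t) : Continuous (trunc t) := by
  unfold trunc
  refine (Complex.continuous_ofReal.comp (Continuous.div continuous_const (by fun_prop) ?_)).mul
    continuous_id
  intro z
  exact (lt_max_of_lt_right ht).ne'

lemma norm_trunc {t : ℝ} (ht : 0 < t) (z : ℂ) : ‖trunc t z‖ = min ‖z‖ t := by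
  unfold trunc
  rw [norm_mul, Complex.norm_real, Real.norm_of_nonneg (by positivity)]
  rcases le_total ‖z‖ t with h | h
  · rw [max_eq_right h, min_eq_left h]; field_simp
  · rw [max_eq_left h, min_eq_right h]
    have : 0 < ‖z‖ := ht.trans_le h
    field_simp

lemma norm_sub_trunc {t : ℝ} (ht : 0 < t) (z : ℂ) :
    ‖z - trunc t z‖ ≤ if t < ‖z‖ then ‖z‖ else 0 := by
  have : z - trunc t z = ((1 - t / max ‖z‖ t : ℝ) : ℂ) * z := by
    unfold trunc; push_cast; ring
  rw [this]
  split_ifs with h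
  · rw [norm_mul, Complex.norm_real]
    apply mul_le_of_le_one_left (norm_nonneg _)
    have h1 : t / max ‖z‖ t ≤ 1 := div_le_one_of_le₀ (le_max_right _ _) (by positivity)
    have h2 : 0 ≤ t / max ‖z‖ t := by positivity
    rw [Real.norm_of_nonneg (by linarith)]
    linarith
  · rw [max_eq_right (not_lt.1 h), div_self ht.ne']
    simp

lemma level_est (hn : 1 ≤ n) (h : IsCZ K B) {f : EuclideanSpace ℝ (Fin n) → ℂ} (hf : Continuous f)
    (hc : HasCompactSupport f) (p t : ℝ) (ht : 0 < t) :
    volume {x | t < ‖T K f x‖ / 4} * ENNReal.ofReal (t ^ (p - 1)) ≤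
      CW n B * (∫⁻ x, F1 p t ‖f x‖) + B * ∫⁻ x, F2 p t ‖f x‖ := by
  set f0 : EuclideanSpace ℝ (Fin n) → ℂ := fun x => trunc t (f x) with hf0
  set f1 : EuclideanSpace ℝ (Fin n) → ℂ := fun x => f x - trunc t (f x) with hf1
  have c0 : Continuous f0 := (continuous_trunc ht).comp hf
  have c1 : Continuous f1 := hf.sub c0
  have s0 : HasCompactSupport f0 := hc.comp_left (g := trunc t) (by simp [trunc])
  have s1 : HasCompactSupport f1 := hc.sub s0
  have i0 := c0.integrable_of_hasCompactSupport (μ := volume) s0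
  have i1 := c1.integrable_of_hasCompactSupport (μ := volume) s1
  have hT : ∀ x, T K f x = T K f1 x + T K f0 x := by
    intro x
    simp only [T]
    rw [← integral_add (integrable_T h i1 x) (integrable_T h i0 x)]
    congr 1; ext y; simp only [hf0, hf1]; ring
  set l := ENNReal.ofReal t with hl
  have hl0 : 0 < l := by simpa [hl] using ht
  have hlt : l ≠ ⊤ := ENNReal.ofReal_ne_top
  have hincl : {x | t < ‖T K f x‖ / 4} ⊆
      {x | 2 * l < ‖T K f1 x‖ₑ} ∪ {x | l ^ 2 ≤ ‖T K f0 x‖ₑ ^ 2} := by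
    intro x hx
    by_contra hcon
    simp only [Set.mem_union, Set.mem_ofPred_eq, not_or, not_lt, not_le] at hcon hx
    obtain ⟨a1, a2⟩ := hcon
    have a2' : ‖T K f0 x‖ₑ < l := lt_of_not_ge fun hh => absurd a2 (not_lt.2 (pow_le_pow_left' hh 2))
    rw [← ofReal_norm, hl, ENNReal.ofReal_lt_ofReal_iff ht] at a2'
    rw [← ofReal_norm, hl, show (2 : ℝ≥0∞) = ENNReal.ofReal 2 by norm_num,
      ← ENNReal.ofReal_mul (by norm_num), ENNReal.ofReal_le_ofReal_iff (by positivity)] at a1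
    have := norm_add_le (T K f1 x) (T K f0 x)
    rw [← hT] at this
    linarith
  have m1 := weak11 hn h c1 s1 l hl0 hlt
  have m2 : volume {x | l ^ 2 ≤ ‖T K f0 x‖ₑ ^ 2} ≤ B * ((l ^ 2)⁻¹ * ∫⁻ x, ‖f0 x‖ₑ ^ 2) := by
    refine (meas_ge_le_lintegral_div
      (((continuous_T h i0).enorm.measurable.pow_const 2).aemeasurable) (by positivity)
      (by finiteness)).trans ?_
    rw [ENNReal.div_eq_inv_mul, mul_left_comm]
    gcongr
    exact h.l2 f0 i0 (c0.memLp_of_hasCompactSupport s0)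
  have n1 : l⁻¹ * (∫⁻ x, ‖f1 x‖ₑ) * ENNReal.ofReal (t ^ (p - 1)) ≤ ∫⁻ x, F1 p t ‖f x‖ := by
    rw [mul_right_comm, ← lintegral_const_mul' _ _ (by
      have := ENNReal.inv_ne_top.2 hl0.ne'; finiteness)]
    apply lintegral_mono
    intro x
    simp only [F1]
    have := norm_sub_trunc ht (f x)
    rw [hl, ← ofReal_norm, ← ENNReal.ofReal_inv_of_pos ht, ← ENNReal.ofReal_mul (by positivity),
      ← ENNReal.ofReal_mul (by positivity)]
    apply ENNReal.ofReal_le_ofReal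
    have e : t⁻¹ * t ^ (p - 1) = t ^ (p - 2) := by
      rw [← Real.rpow_neg_one, ← Real.rpow_add ht]; congr 1; ring
    rw [e, mul_comm]
    split_ifs with hh
    · rw [if_pos hh] at this
      gcongr
    · rw [if_neg hh] at this
      have : ‖f1 x‖ = 0 := le_antisymm this (norm_nonneg _)
      rw [this]; simp
  have n2 : (l ^ 2)⁻¹ * (∫⁻ x, ‖f0 x‖ₑ ^ 2) * ENNReal.ofReal (t ^ (p - 1)) ≤
      ∫⁻ x, F2 p t ‖f x‖ := by
    rw [mul_right_comm, ← lintegral_const_mul' _ _ (by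
      have : (l ^ 2)⁻¹ ≠ ⊤ := ENNReal.inv_ne_top.2 (pow_ne_zero 2 hl0.ne')
      finiteness)]
    apply lintegral_mono
    intro x
    simp only [F2]
    rw [hl, ← ofReal_norm, ← ENNReal.ofReal_pow ht.le, ← ENNReal.ofReal_pow (norm_nonneg _),
      ← ENNReal.ofReal_inv_of_pos (by positivity), ← ENNReal.ofReal_mul (by positivity),
      ← ENNReal.ofReal_mul (by positivity), hf0, norm_trunc ht]
    apply ENNReal.ofReal_le_ofReal
    have e : (t ^ 2)⁻¹ * t ^ (p - 1) = t ^ (p - 3) := by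
      rw [← Real.rpow_natCast, ← Real.rpow_neg ht.le, ← Real.rpow_add ht]
      congr 1; push_cast; ring
    rw [e, mul_comm]
  calc volume {x | t < ‖T K f x‖ / 4} * ENNReal.ofReal (t ^ (p - 1))
      ≤ (CW n B * (l⁻¹ * ∫⁻ x, ‖f1 x‖ₑ) + B * ((l ^ 2)⁻¹ * ∫⁻ x, ‖f0 x‖ₑ ^ 2)) *
          ENNReal.ofReal (t ^ (p - 1)) := by
        gcongr
        exact (measure_mono hincl).trans ((measure_union_le _ _).trans (add_le_add m1 m2))
    _ = CW n B * (l⁻¹ * (∫⁻ x, ‖f1 x‖ₑ) * ENNReal.ofReal (t ^ (p - 1))) +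
        B * ((l ^ 2)⁻¹ * (∫⁻ x, ‖f0 x‖ₑ ^ 2) * ENNReal.ofReal (t ^ (p - 1))) := by ring
    _ ≤ _ := by gcongr

def CS (n : ℕ) (p : ℝ) (B : ℝ≥0∞) : ℝ≥0∞ :=
  ENNReal.ofReal (4 ^ p) * (ENNReal.ofReal p * (CW n B * ENNReal.ofReal (1 / (p - 1)) +
    B * ENNReal.ofReal (1 / p + 1 / (2 - p))))

lemma CS_ne_top {p : ℝ} (hB : B ≠ ⊤) : CS n p B ≠ ⊤ := by
  unfold CS
  have := CW_ne_top (n := n) hB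
  finiteness

lemma ofReal_norm_rpow {p : ℝ} (hp : 0 ≤ p) (z : ℂ) : ENNReal.ofReal (‖z‖ ^ p) = ‖z‖ₑ ^ p := by
  rw [← ofReal_norm, ENNReal.ofReal_rpow_of_nonneg (norm_nonneg _) hp]

theorem strong_lt2 (hn : 1 ≤ n) (h : IsCZ K B) {f : EuclideanSpace ℝ (Fin n) → ℂ}
    (hf : Continuous f) (hc : HasCompactSupport f) {p : ℝ} (hp : 1 < p) (hp2 : p < 2) :
    ∫⁻ x, ‖T K f x‖ₑ ^ p ≤ CS n p B * ∫⁻ x, ‖f x‖ₑ ^ p := by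
  have hfi := hf.integrable_of_hasCompactSupport (μ := volume) hc
  have hp0 : 0 < p := by linarith
  have hm1 : Measurable (Function.uncurry fun (t : ℝ) (x : EuclideanSpace ℝ (Fin n)) =>
      F1 p t ‖f x‖) := by
    unfold F1
    apply Measurable.ennreal_ofReal
    apply Measurable.ite
    · exact measurableSet_lt measurable_fst (hf.measurable.norm.comp measurable_snd)
    · exact (hf.measurable.norm.comp measurable_snd).mul (measurable_fst.pow_const _)
    · exact measurable_const
  have hm2 : Measurable (Function.uncurry fun (t : ℝ) (x : EuclideanSpace ℝ (Fin n)) =>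
      F2 p t ‖f x‖) := by
    unfold F2
    apply Measurable.ennreal_ofReal
    exact ((((hf.measurable.norm.comp measurable_snd).min measurable_fst)).pow_const 2).mul
      (measurable_fst.pow_const _)
  have key := lintegral_rpow_eq_lintegral_meas_lt_mul (volume : Measure (EuclideanSpace ℝ (Fin n)))
    (f := fun x => ‖T K f x‖ / 4) (Filter.Eventually.of_forall fun x => by positivity)
    (((continuous_T h hfi).norm.div_const 4).aemeasurable) hp0
  have hle : ∫⁻ x, ENNReal.ofReal ((‖T K f x‖ / 4) ^ p) ≤
      ENNReal.ofReal p * (CW n B * ENNReal.ofReal (1 / (p - 1)) +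
        B * ENNReal.ofReal (1 / p + 1 / (2 - p))) * ∫⁻ x, ‖f x‖ₑ ^ p := by
    rw [key, mul_assoc]
    gcongr
    calc ∫⁻ t in Set.Ioi 0, volume {x | t < ‖T K f x‖ / 4} * ENNReal.ofReal (t ^ (p - 1))
        ≤ ∫⁻ t in Set.Ioi 0, (CW n B * (∫⁻ x, F1 p t ‖f x‖) + B * ∫⁻ x, F2 p t ‖f x‖) :=
          setLIntegral_mono' measurableSet_Ioi fun t ht => level_est hn h hf hc p t ht
      _ = CW n B * (∫⁻ t in Set.Ioi 0, ∫⁻ x, F1 p t ‖f x‖) +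
          B * ∫⁻ t in Set.Ioi 0, ∫⁻ x, F2 p t ‖f x‖ := by
          rw [lintegral_add_left, lintegral_const_mul, lintegral_const_mul]
          · exact hm2.lintegral_prod_right
          · exact hm1.lintegral_prod_right
          · exact hm1.lintegral_prod_right.const_mul _
      _ = CW n B * (∫⁻ x, ∫⁻ t in Set.Ioi 0, F1 p t ‖f x‖) +
          B * ∫⁻ x, ∫⁻ t in Set.Ioi 0, F2 p t ‖f x‖ := by
          rw [lintegral_lintegral_swap hm1.aemeasurable, lintegral_lintegral_swap hm2.aemeasurable]
      _ ≤ CW n B * (∫⁻ x, ENNReal.ofReal (1 / (p - 1)) * ‖f x‖ₑ ^ p) +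
          B * ∫⁻ x, ENNReal.ofReal (1 / p + 1 / (2 - p)) * ‖f x‖ₑ ^ p := by
          gcongr with x x
          · rw [← ofReal_norm_rpow hp0.le]
            exact F1_int hp (norm_nonneg _)
          · rw [← ofReal_norm_rpow hp0.le]
            exact F2_int hp hp2 (norm_nonneg _)
      _ = _ := by
          rw [lintegral_const_mul' _ _ ENNReal.ofReal_ne_top,
            lintegral_const_mul' _ _ ENNReal.ofReal_ne_top]
          ring
  calc ∫⁻ x, ‖T K f x‖ₑ ^ p
      = ∫⁻ x, ENNReal.ofReal (4 ^ p) * ENNReal.ofReal ((‖T K f x‖ / 4) ^ p) := by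
        congr 1; ext x
        rw [← ofReal_norm_rpow hp0.le, ← ENNReal.ofReal_mul (by positivity),
          ← Real.mul_rpow (by norm_num) (by positivity)]
        congr 2
        ring
    _ = ENNReal.ofReal (4 ^ p) * ∫⁻ x, ENNReal.ofReal ((‖T K f x‖ / 4) ^ p) :=
        lintegral_const_mul' _ _ ENNReal.ofReal_ne_top
    _ ≤ _ := by
        rw [CS, mul_assoc]
        gcongr

end CZ

namespace CZ
open scoped ENNReal NNReal

variable {n : ℕ} {K : EuclideanSpace ℝ (Fin n) → ℂ} {B : ℝ≥0∞}

lemma T_dual (h : IsCZ K B) {f g : EuclideanSpace ℝ (Fin n) → ℂ}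
    (hf : Integrable f) (hg : Integrable g) :
    ∫ x, T K f x * g x = ∫ y, f y * T (fun x => K (-x)) g y := by
  obtain ⟨M, hM⟩ := h.bdd
  have hc := h.cont
  have hfint : Integrable (Function.uncurry fun x y => K (x - y) * (g x * f y))
      ((volume : Measure (EuclideanSpace ℝ (Fin n))).prod volume) := by
    refine (hg.mul_prod hf).bdd_mul (c := M) ?_ (Filter.Eventually.of_forall fun p => hM _)
    exact (by fun_prop : Continuous fun p : EuclideanSpace ℝ (Fin n) × EuclideanSpace ℝ (Fin n) =>
      K (p.1 - p.2)).aestronglyMeasurable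
  calc ∫ x, T K f x * g x = ∫ x, ∫ y, K (x - y) * (g x * f y) := by
        congr 1; ext x
        rw [T, ← integral_mul_const]
        congr 1; ext y; ring
    _ = ∫ y, ∫ x, K (x - y) * (g x * f y) := integral_integral_swap hfint
    _ = _ := by
        congr 1; ext y
        rw [T, ← integral_const_mul]
        congr 1; ext x
        rw [neg_sub]; ring

lemma ennreal_absorb {I F C : ℝ≥0∞} {p q : ℝ} (hpq : p.HolderConjugate q) (hI : I ≠ ⊤)
    (h : I ≤ F ^ (1 / p) * (C * I) ^ (1 / q)) : I ≤ C ^ (p - 1) * F := by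
  have hp := hpq.pos
  have hq := hpq.symm.pos
  rcases eq_or_ne I 0 with h0 | h0
  · simp [h0]
  have e : I = I ^ (1 / p) * I ^ (1 / q) := by
    rw [← ENNReal.rpow_add _ _ h0 hI]
    have : 1 / p + 1 / q = 1 := by simpa using hpq.inv_add_inv_eq_one
    rw [this, ENNReal.rpow_one]
  rw [ENNReal.mul_rpow_of_nonneg _ _ (by positivity), ← mul_assoc] at h
  have h2 : I ^ (1 / p) * I ^ (1 / q) ≤ F ^ (1 / p) * C ^ (1 / q) * I ^ (1 / q) := by
    rw [← e]; exact h
  have h3 : I ^ (1 / p) ≤ F ^ (1 / p) * C ^ (1 / q) := by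
    refine (ENNReal.mul_le_mul_iff_left ?_ ?_).1 h2
    · exact (ENNReal.rpow_pos (pos_iff_ne_zero.2 h0) hI).ne'
    · exact ENNReal.rpow_ne_top_of_nonneg (by positivity) hI
  have h4 := ENNReal.rpow_le_rpow h3 hp.le
  rw [ENNReal.mul_rpow_of_nonneg _ _ hp.le, ← ENNReal.rpow_mul, ← ENNReal.rpow_mul,
    ← ENNReal.rpow_mul, one_div_mul_cancel hp.ne', ENNReal.rpow_one, ENNReal.rpow_one] at h4
  have : 1 / q * p = p - 1 := by
    have := hpq.inv_add_inv_eq_one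
    field_simp at this ⊢
    linarith
  rw [this, mul_comm] at h4
  exact h4

theorem strong_gt2 (hn : 1 ≤ n) (h : IsCZ K B) (h' : IsCZ (fun x => K (-x)) B)
    {f : EuclideanSpace ℝ (Fin n) → ℂ}
    (hf : Continuous f) (hc : HasCompactSupport f) {p : ℝ} (hp : 2 < p) :
    ∫⁻ x, ‖T K f x‖ₑ ^ p ≤ CS n (p / (p - 1)) B ^ (p - 1) * ∫⁻ x, ‖f x‖ₑ ^ p := by
  have hfi := hf.integrable_of_hasCompactSupport (μ := volume) hc
  have hp0 : 0 < p := by linarith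
  set q := p / (p - 1) with hq
  have hpq : p.HolderConjugate q := Real.HolderConjugate.conjExponent (by linarith)
  have hq1 : 1 < q := hpq.symm.lt
  have hq2 : q < 2 := by rw [hq, div_lt_iff₀ (by linarith)]; linarith
  have hTc := continuous_T h hfi
  let χ : ℕ → EuclideanSpace ℝ (Fin n) → ℝ := fun N x => max 0 (min 1 (N + 1 - ‖x‖))
  have χc : ∀ N, Continuous (χ N) := fun N => by simp only [χ]; fun_prop
  have χ0 : ∀ N x, 0 ≤ χ N x := fun N x => le_max_left _ _
  have χ1 : ∀ N x, χ N x ≤ 1 := fun N x => max_le zero_le_one (min_le_left _ _)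
  have χs : ∀ N, HasCompactSupport (χ N) := fun N => by
    apply HasCompactSupport.intro (isCompact_closedBall (0 : EuclideanSpace ℝ (Fin n)) (N + 1))
    intro x hx
    simp only [Metric.mem_closedBall, dist_zero_right, not_le] at hx
    simp only [χ]
    apply max_eq_left
    exact (min_le_right _ _).trans (by linarith)
  have key : ∀ N, ∫⁻ x, ENNReal.ofReal (χ N x * ‖T K f x‖ ^ p) ≤
      CS n q B ^ (p - 1) * ∫⁻ x, ‖f x‖ₑ ^ p := by
    intro N
    have cI : Continuous fun x => χ N x * ‖T K f x‖ ^ p :=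
      (χc N).mul (hTc.norm.rpow_const fun _ => Or.inr hp0.le)
    have iI : Integrable fun x => χ N x * ‖T K f x‖ ^ p :=
      cI.integrable_of_hasCompactSupport (χs N).mul_right
    set g : EuclideanSpace ℝ (Fin n) → ℂ := fun x =>
      ((χ N x * ‖T K f x‖ ^ (p - 2) : ℝ) : ℂ) * (starRingEnd ℂ) (T K f x) with hg
    have gc : Continuous g := by
      refine (Complex.continuous_ofReal.comp ((χc N).mul
        (hTc.norm.rpow_const fun _ => Or.inr (by linarith)))).mul
        (Complex.continuous_conj.comp hTc)
    have gs : HasCompactSupport g := by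
      have : HasCompactSupport fun x => ((χ N x * ‖T K f x‖ ^ (p - 2) : ℝ) : ℂ) :=
        ((χs N).mul_right (f' := fun x => ‖T K f x‖ ^ (p - 2))).comp_left
          (g := fun r : ℝ => (r : ℂ)) Complex.ofReal_zero
      exact this.mul_right
    have gi := gc.integrable_of_hasCompactSupport (μ := volume) gs
    have hTg : ∀ x, T K f x * g x = ((χ N x * ‖T K f x‖ ^ p : ℝ) : ℂ) := by
      intro x
      have e1 : T K f x * g x = ((χ N x * ‖T K f x‖ ^ (p - 2) : ℝ) : ℂ) *
          (T K f x * (starRingEnd ℂ) (T K f x)) := by simp only [hg]; ring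
      rw [e1, Complex.mul_conj, Complex.normSq_eq_norm_sq, ← Complex.ofReal_mul, mul_assoc]
      congr 2
      rcases (norm_nonneg (T K f x)).eq_or_lt with hz | hz
      · rw [← hz, Real.zero_rpow hp0.ne']; simp
      · rw [← Real.rpow_natCast, ← Real.rpow_add hz]
        congr 1; push_cast; ring
    have hgn : ∀ x, ‖g x‖ₑ ^ q ≤ ENNReal.ofReal (χ N x * ‖T K f x‖ ^ p) := by
      intro x
      rw [← ofReal_norm_rpow (by linarith)]
      apply ENNReal.ofReal_le_ofReal
      have e1 : ‖g x‖ = χ N x * ‖T K f x‖ ^ (p - 1) := by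
        simp only [hg]
        rw [norm_mul, Complex.norm_real, Real.norm_of_nonneg (mul_nonneg (χ0 N x) (by positivity)),
          RCLike.norm_conj, mul_assoc]
        congr 1
        rw [← Real.rpow_add_one' (norm_nonneg _) (by linarith)]
        congr 1; ring
      rw [e1, Real.mul_rpow (χ0 N x) (by positivity), ← Real.rpow_mul (norm_nonneg _)]
      have e2 : (p - 1) * q = p := by
        rw [hq]; have : p - 1 ≠ 0 := by linarith
        field_simp
      rw [e2]
      gcongr
      calc χ N x ^ q ≤ χ N x ^ (1 : ℝ) :=
            Real.rpow_le_rpow_of_exponent_ge_of_imp (χ0 N x) (χ1 N x) hq1.le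
              (fun _ h1 => absurd h1 (by linarith))
        _ = χ N x := Real.rpow_one _
    apply ennreal_absorb hpq
    · exact iI.lintegral_lt_top.ne
    · have e1 : ∫⁻ x, ENNReal.ofReal (χ N x * ‖T K f x‖ ^ p) = ‖∫ x, T K f x * g x‖ₑ := by
        simp_rw [hTg]
        rw [integral_complex_ofReal, ← ofReal_norm, Complex.norm_real, Real.norm_of_nonneg,
          ofReal_integral_eq_lintegral_ofReal iI]
        · exact Filter.Eventually.of_forall fun x => mul_nonneg (χ0 N x) (by positivity)
        · exact integral_nonneg fun x => mul_nonneg (χ0 N x) (by positivity)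
      have hgi' := continuous_T h' gi
      calc ∫⁻ x, ENNReal.ofReal (χ N x * ‖T K f x‖ ^ p) = ‖∫ x, T K f x * g x‖ₑ := e1
        _ = ‖∫ y, f y * T (fun x => K (-x)) g y‖ₑ := by rw [T_dual h hfi gi]
        _ ≤ ∫⁻ y, ‖f y‖ₑ * ‖T (fun x => K (-x)) g y‖ₑ := by
            refine (enorm_integral_le_lintegral_enorm _).trans (le_of_eq ?_)
            simp_rw [enorm_mul]
        _ ≤ (∫⁻ y, ‖f y‖ₑ ^ p) ^ (1 / p) * (∫⁻ y, ‖T (fun x => K (-x)) g y‖ₑ ^ q) ^ (1 / q) :=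
            ENNReal.lintegral_mul_le_Lp_mul_Lq _ hpq hf.enorm.measurable.aemeasurable
              hgi'.enorm.measurable.aemeasurable
        _ ≤ _ := by
            gcongr
            refine (strong_lt2 hn h' gc gs hq1 hq2).trans ?_
            gcongr with x
            exact hgn x
  have hlim : ∀ x, Filter.Tendsto (fun N => ENNReal.ofReal (χ N x * ‖T K f x‖ ^ p)) Filter.atTop
      (nhds (‖T K f x‖ₑ ^ p)) := by
    intro x
    apply tendsto_const_nhds.congr'
    filter_upwards [Filter.eventually_ge_atTop ⌈‖x‖⌉₊] with N hN
    have : ‖x‖ ≤ N := (Nat.le_ceil _).trans (by exact_mod_cast hN)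
    have e : χ N x = 1 := by
      simp only [χ]
      rw [min_eq_left (by linarith)]; simp
    rw [e, one_mul, ofReal_norm_rpow hp0.le]
  calc ∫⁻ x, ‖T K f x‖ₑ ^ p
      = ∫⁻ x, Filter.liminf (fun N => ENNReal.ofReal (χ N x * ‖T K f x‖ ^ p)) Filter.atTop := by
        congr 1; ext x; exact (hlim x).liminf_eq.symm
    _ ≤ Filter.liminf (fun N => ∫⁻ x, ENNReal.ofReal (χ N x * ‖T K f x‖ ^ p)) Filter.atTop := by
        apply lintegral_liminf_le
        intro N
        exact ((χc N).mul (hTc.norm.rpow_const fun _ => Or.inr hp0.le)).measurable.ennreal_ofReal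
    _ ≤ _ := by
        apply Filter.liminf_le_of_le
        · isBoundedDefault
        · intro b hb
          obtain ⟨N, hN⟩ := hb.exists
          exact hN.trans (key N)

def CP (n : ℕ) (p : ℝ) (B : ℝ≥0∞) : ℝ≥0∞ :=
  CS n p B + B + CS n (p / (p - 1)) B ^ (p - 1)

lemma CP_ne_top {p : ℝ} (hp : 1 < p) (hB : B ≠ ⊤) : CP n p B ≠ ⊤ := by
  unfold CP
  have h1 := CS_ne_top (n := n) (p := p) hB
  have h2 := CS_ne_top (n := n) (p := p / (p - 1)) hB
  have h3 := ENNReal.rpow_ne_top_of_nonneg (y := p - 1) (by linarith) h2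
  finiteness

theorem strong (hn : 1 ≤ n) (h : IsCZ K B) (h' : IsCZ (fun x => K (-x)) B)
    {f : EuclideanSpace ℝ (Fin n) → ℂ}
    (hf : Continuous f) (hc : HasCompactSupport f) {p : ℝ} (hp : 1 < p) :
    ∫⁻ x, ‖T K f x‖ₑ ^ p ≤ CP n p B * ∫⁻ x, ‖f x‖ₑ ^ p := by
  rcases lt_trichotomy p 2 with h2 | h2 | h2
  · refine (strong_lt2 hn h hf hc hp h2).trans ?_
    gcongr
    unfold CP
    rw [add_assoc]
    exact le_self_add
  · have := h.l2 f (hf.integrable_of_hasCompactSupport hc) (hf.memLp_of_hasCompactSupport hc)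
    subst h2
    simp only [ENNReal.rpow_ofNat]
    refine this.trans ?_
    gcongr
    unfold CP
    exact le_add_self.trans le_self_add
  · refine (strong_gt2 hn h h' hf hc h2).trans ?_
    gcongr
    unfold CP
    exact le_add_self

end CZ

namespace CZ
open scoped ENNReal NNReal FourierTransform SchwartzMap

section P6
variable {n : ℕ}

local notation "X" => EuclideanSpace ℝ (Fin n)

lemma T_eq_convolution (K f : 𝓢(X, ℂ)) (x : X) :
    T K f x = SchwartzMap.convolution (ContinuousLinearMap.mul ℂ ℂ) f K x := by
  rw [SchwartzMap.convolution_apply]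
  unfold T convolution
  congr 1; ext y; simp [mul_comm]

lemma fourier_T (g f : 𝓢(X, ℂ)) (ξ : X) :
    𝓕 (SchwartzMap.convolution (ContinuousLinearMap.mul ℂ ℂ) f (𝓕⁻ g)) ξ = g ξ * 𝓕 f ξ := by
  rw [SchwartzMap.fourier_convolution]
  simp [mul_comm]

lemma lint_sq_eq (f : 𝓢(X, ℂ)) : ∫⁻ x, ‖f x‖ₑ ^ 2 = ENNReal.ofReal (∫ x, ‖f x‖ ^ 2) := by
  rw [ofReal_integral_eq_lintegral_ofReal]
  · congr 1; ext x
    rw [ENNReal.ofReal_pow (norm_nonneg _), ofReal_norm]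
  · exact (f.memLp 2).integrable_norm_pow (by norm_num)
  · exact Filter.Eventually.of_forall fun x => by positivity

lemma l2_schwartz (g f : 𝓢(X, ℂ)) {M : ℝ} (hM : ∀ ξ, ‖g ξ‖ ≤ M) :
    ∫⁻ x, ‖T (𝓕⁻ g : 𝓢(X, ℂ)) f x‖ₑ ^ 2 ≤ ENNReal.ofReal (M ^ 2) * ∫⁻ x, ‖f x‖ₑ ^ 2 := by
  simp_rw [T_eq_convolution]
  rw [lint_sq_eq, lint_sq_eq, ← ENNReal.ofReal_mul (by positivity),
    ← SchwartzMap.integral_norm_sq_fourier, ← SchwartzMap.integral_norm_sq_fourier f,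
    ← integral_const_mul]
  apply ENNReal.ofReal_le_ofReal
  apply integral_mono
  · exact ((SchwartzMap.memLp _ 2 volume).integrable_norm_pow (by norm_num))
  · exact ((SchwartzMap.memLp (𝓕 f) 2 volume).integrable_norm_pow (by norm_num)).const_mul _
  · intro ξ
    simp only
    rw [fourier_T, norm_mul, mul_pow]
    gcongr
    exact hM ξ

lemma tendsto_eLpNorm_aux {f : X → ℂ} (hf2 : MemLp f 2) {h : ℕ → X → ℂ} (hh : ∀ i, MemLp (h i) 2)
    (hlim0 : Filter.Tendsto (fun i => eLpNorm (f - h i) 2) Filter.atTop (nhds 0)) :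
    Filter.Tendsto (fun i => eLpNorm (h i) 2) Filter.atTop (nhds (eLpNorm f 2)) := by
  have ha : ∀ i, eLpNorm (h i) 2 ≤ eLpNorm f 2 + eLpNorm (f - h i) 2 := by
    intro i
    have : h i = f - (f - h i) := by simp
    conv_lhs => rw [this]
    exact eLpNorm_sub_le hf2.aestronglyMeasurable
      (hf2.aestronglyMeasurable.sub (hh i).aestronglyMeasurable) (by norm_num)
  have hb : ∀ i, eLpNorm f 2 - eLpNorm (f - h i) 2 ≤ eLpNorm (h i) 2 := by
    intro i
    rw [tsub_le_iff_right, add_comm]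
    have : f = (f - h i) + h i := by simp
    conv_lhs => rw [this]
    exact eLpNorm_add_le (hf2.aestronglyMeasurable.sub (hh i).aestronglyMeasurable)
      (hh i).aestronglyMeasurable (by norm_num)
  refine tendsto_of_tendsto_of_tendsto_of_le_of_le ?_ ?_ hb ha
  · have h5 := ENNReal.Tendsto.sub (tendsto_const_nhds (x := eLpNorm f 2 volume)
      (f := (Filter.atTop : Filter ℕ))) hlim0 (Or.inl hf2.eLpNorm_ne_top)
    rw [tsub_zero] at h5
    exact h5
  · have h5 := (tendsto_const_nhds (x := eLpNorm f 2 volume)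
      (f := (Filter.atTop : Filter ℕ))).add hlim0
    rw [add_zero] at h5
    exact h5

lemma l2_bound (g : 𝓢(X, ℂ)) {M : ℝ} (hM : ∀ ξ, ‖g ξ‖ ≤ M) (f : X → ℂ) (hf : Integrable f)
    (hf2 : MemLp f 2) :
    ∫⁻ x, ‖T (𝓕⁻ g : 𝓢(X, ℂ)) f x‖ₑ ^ 2 ≤ ENNReal.ofReal (M ^ 2) * ∫⁻ x, ‖f x‖ₑ ^ 2 := by
  set K : 𝓢(X, ℂ) := 𝓕⁻ g with hK
  have hex : ∀ i : ℕ, ∃ h : 𝓢(X, ℂ), eLpNorm (f - ⇑h) 2 ≤ ENNReal.ofReal (1 / ((i : ℝ) + 1)) := by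
    intro i
    obtain ⟨h, h1, h2, h3⟩ := hf2.exist_eLpNorm_sub_le (by norm_num) (by norm_num)
      (show (0 : ℝ) < 1 / ((i : ℝ) + 1) by positivity)
    exact ⟨h1.toSchwartzMap h2, h3⟩
  choose h hh using hex
  have hlim0 : Filter.Tendsto (fun i => eLpNorm (f - ⇑(h i)) 2) Filter.atTop (nhds 0) := by
    refine tendsto_of_tendsto_of_tendsto_of_le_of_le tendsto_const_nhds ?_ (fun _ => zero_le) hh
    rw [← ENNReal.ofReal_zero]
    exact ENNReal.tendsto_ofReal tendsto_one_div_add_atTop_nhds_zero_nat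
  have e2 : ∀ w : X → ℂ, ∫⁻ x, ‖w x‖ₑ ^ 2 = eLpNorm w 2 ^ 2 := by
    intro w
    have := eLpNorm_nnreal_pow_eq_lintegral (f := w) (μ := volume) (p := 2) (by norm_num)
    simpa using this.symm
  have hpt : ∀ x, Filter.Tendsto (fun i => T K (h i) x) Filter.atTop (nhds (T K f x)) := by
    intro x
    have hKx : MemLp (fun y => K (x - y)) 2 :=
      (K.memLp 2).comp_measurePreserving (Measure.measurePreserving_sub_left volume x)
    rw [tendsto_iff_norm_sub_tendsto_zero]
    have hb : ∀ i, ENNReal.ofReal ‖T K (h i) x - T K f x‖ ≤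
        eLpNorm (fun y => K (x - y)) 2 * eLpNorm (f - ⇑(h i)) 2 := by
      intro i
      have i1 : Integrable fun y => K (x - y) * h i y :=
        memLp_one_iff_integrable.1 (((h i).memLp 2).mul' (r := 1) hKx)
      have i2 : Integrable fun y => K (x - y) * f y :=
        memLp_one_iff_integrable.1 (hf2.mul' (r := 1) hKx)
      unfold T
      rw [norm_sub_rev, ← integral_sub i2 i1, ofReal_norm]
      refine (enorm_integral_le_lintegral_enorm _).trans ?_
      rw [← eLpNorm_one_eq_lintegral_enorm]
      have := eLpNorm_smul_le_mul_eLpNorm (p := 2) (q := 2) (r := 1) (μ := volume)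
        (f := f - ⇑(h i)) (φ := fun y => K (x - y))
        (hf2.aestronglyMeasurable.sub ((h i).memLp 2).aestronglyMeasurable) hKx.aestronglyMeasurable
      refine le_trans (le_of_eq ?_) this
      congr 1; ext y; simp [mul_sub]
    have : Filter.Tendsto (fun i => ENNReal.ofReal ‖T K (h i) x - T K f x‖) Filter.atTop
        (nhds 0) := by
      refine tendsto_of_tendsto_of_tendsto_of_le_of_le tendsto_const_nhds ?_ (fun _ => zero_le) hb
      simpa using ENNReal.Tendsto.const_mul hlim0 (Or.inr hKx.eLpNorm_ne_top)
    have h3 := (ENNReal.tendsto_toReal ENNReal.zero_ne_top).comp this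
    refine h3.congr fun i => ?_
    simp
  have hlim : Filter.Tendsto (fun i => ENNReal.ofReal (M ^ 2) * ∫⁻ x, ‖h i x‖ₑ ^ 2) Filter.atTop
      (nhds (ENNReal.ofReal (M ^ 2) * ∫⁻ x, ‖f x‖ₑ ^ 2)) := by
    apply ENNReal.Tendsto.const_mul _ (Or.inr ENNReal.ofReal_ne_top)
    simp_rw [e2]
    apply ENNReal.Tendsto.pow
    exact tendsto_eLpNorm_aux hf2 (fun i => (h i).memLp 2) hlim0
  have hm : ∀ i, Measurable fun x => ‖T K (h i) x‖ₑ ^ 2 := by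
    intro i
    simp_rw [T_eq_convolution]
    exact ((SchwartzMap.continuous _).enorm.measurable).pow_const 2
  calc ∫⁻ x, ‖T K f x‖ₑ ^ 2 = ∫⁻ x, Filter.liminf (fun i => ‖T K (h i) x‖ₑ ^ 2) Filter.atTop := by
        congr 1; ext x
        exact (ENNReal.Tendsto.pow (hpt x).enorm).liminf_eq.symm
    _ ≤ Filter.liminf (fun i => ∫⁻ x, ‖T K (h i) x‖ₑ ^ 2) Filter.atTop := lintegral_liminf_le hm
    _ ≤ Filter.liminf (fun i => ENNReal.ofReal (M ^ 2) * ∫⁻ x, ‖h i x‖ₑ ^ 2) Filter.atTop := by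
        exact Filter.liminf_le_liminf
          (Filter.Eventually.of_forall fun i => l2_schwartz g (h i) hM)
    _ = _ := hlim.liminf_eq

lemma IsCZ.refl {K : X → ℂ} {B : ℝ≥0∞} (h : IsCZ K B) : IsCZ (fun x => K (-x)) B where
  cont := h.cont.comp continuous_neg
  bdd := by obtain ⟨M, hM⟩ := h.bdd; exact ⟨M, fun x => hM _⟩
  l2 := by
    intro f hf hf2
    have hmp : MeasurePreserving (fun x : X => -x) := Measure.measurePreserving_neg volume
    have := h.l2 (fun x => f (-x)) (hmp.integrable_comp_of_integrable hf) (hf2.comp_measurePreserving hmp)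
    rw [lintegral_neg_eq_self (fun x : X => ‖f x‖ₑ ^ 2) ] at this
    refine le_trans (le_of_eq ?_) this
    rw [← lintegral_neg_eq_self]
    congr 1; ext x
    congr 2
    unfold T
    rw [← integral_neg_eq_self]
    congr 1; ext y
    congr 2; abel
  hor := by
    intro y
    refine le_trans (le_of_eq ?_) (h.hor (-y))
    have hms : ∀ y : X, MeasurableSet {x : X | 2 * ‖y‖ ≤ ‖x‖} := fun y =>
      measurableSet_le (by fun_prop) (by fun_prop)
    rw [← lintegral_indicator (hms _), ← lintegral_indicator (hms _), ← lintegral_neg_eq_self]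
    congr 1; ext x
    simp only [Set.indicator_apply, Set.mem_ofPred_eq, norm_neg]
    congr 4
    · abel
    · simp

end P6
end CZ

namespace CZ
open scoped ENNReal NNReal FourierTransform SchwartzMap

section P7
variable {n : ℕ}

local notation "X" => EuclideanSpace ℝ (Fin n)

lemma hor_ptwise (Ψ : 𝓢(X, ℂ)) : ∃ C : ℝ, 0 ≤ C ∧ ∀ x y : X, 2 * ‖y‖ ≤ ‖x‖ →
    ‖Ψ (x - y) - Ψ x‖ ≤ C * ‖y‖ * (1 + ‖x‖) ^ (-((n : ℝ) + 1)) := by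
  set C0 : ℝ := 2 ^ (n + 1) * ((Finset.Iic (n + 1, 1)).sup
    fun m => SchwartzMap.seminorm ℝ m.1 m.2) Ψ with hC0
  have hC : ∀ z : X, (1 + ‖z‖) ^ (n + 1) * ‖fderiv ℝ Ψ z‖ ≤ C0 := by
    intro z
    have := SchwartzMap.one_add_le_sup_seminorm_apply (𝕜 := ℝ) (m := (n + 1, 1)) (k := n + 1) (n := 1)
      le_rfl le_rfl Ψ z
    rwa [norm_iteratedFDeriv_one] at this
  have hC00 : 0 ≤ C0 := le_trans (by positivity) (hC 0)
  refine ⟨C0 * 2 ^ (n + 1), by positivity, fun x y hxy => ?_⟩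
  have hb : ∀ z ∈ Metric.closedBall x ‖y‖, ‖fderiv ℝ Ψ z‖ ≤
      C0 * 2 ^ (n + 1) * (1 + ‖x‖) ^ (-((n : ℝ) + 1)) := by
    intro z hz
    rw [mem_closedBall_iff_norm] at hz
    have h1 : ‖x‖ ≤ ‖z‖ + ‖y‖ := by
      have := norm_sub_norm_le x z
      rw [norm_sub_rev] at this; linarith
    have h2 : (1 + ‖x‖) / 2 ≤ 1 + ‖z‖ := by linarith [norm_nonneg x]
    have h3 : ((1 + ‖x‖) / 2) ^ (n + 1) * ‖fderiv ℝ Ψ z‖ ≤ C0 := by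
      refine le_trans ?_ (hC z)
      gcongr
    have h4 : (1 + ‖x‖) ^ (-((n : ℝ) + 1)) = ((1 + ‖x‖) ^ (n + 1))⁻¹ := by
      rw [Real.rpow_neg (by positivity), ← Real.rpow_natCast]; push_cast; rfl
    rw [h4, ← div_eq_mul_inv, le_div_iff₀ (by positivity)]
    rw [div_pow, div_mul_eq_mul_div, div_le_iff₀ (by positivity)] at h3
    linarith
  have := (convex_closedBall x ‖y‖).norm_image_sub_le_of_norm_fderiv_le (𝕜 := ℝ) (f := Ψ)
    (fun z _ => Ψ.differentiableAt) hb (Metric.mem_closedBall_self (norm_nonneg _))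
    (y := x - y) (by simp)
  refine this.trans (le_of_eq ?_)
  rw [show x - y - x = -y by abel, norm_neg]
  ring

lemma hor_small (Ψ : 𝓢(X, ℂ)) : ∃ C : ℝ, 0 ≤ C ∧ ∀ y : X,
    ∫⁻ x in {x | 2 * ‖y‖ ≤ ‖x‖}, ‖Ψ (x - y) - Ψ x‖ₑ ≤ ENNReal.ofReal (C * ‖y‖) := by
  obtain ⟨C, hC, h⟩ := hor_ptwise Ψ
  have hI : Integrable (fun x : X => (1 + ‖x‖) ^ (-((n : ℝ) + 1))) :=
    integrable_one_add_norm (by simp)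
  have hI0 : 0 ≤ ∫ x : X, (1 + ‖x‖) ^ (-((n : ℝ) + 1)) := integral_nonneg fun x => by positivity
  refine ⟨C * ∫ x : X, (1 + ‖x‖) ^ (-((n : ℝ) + 1)), by positivity, fun y => ?_⟩
  have hms : MeasurableSet {x : X | 2 * ‖y‖ ≤ ‖x‖} := measurableSet_le (by fun_prop) (by fun_prop)
  calc ∫⁻ x in {x | 2 * ‖y‖ ≤ ‖x‖}, ‖Ψ (x - y) - Ψ x‖ₑ
      ≤ ∫⁻ x in {x : X | 2 * ‖y‖ ≤ ‖x‖}, ENNReal.ofReal (C * ‖y‖ * (1 + ‖x‖) ^ (-((n : ℝ) + 1))) := by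
        apply setLIntegral_mono' hms
        intro x hx
        rw [← ofReal_norm]
        exact ENNReal.ofReal_le_ofReal (h x y hx)
    _ ≤ ∫⁻ x : X, ENNReal.ofReal (C * ‖y‖ * (1 + ‖x‖) ^ (-((n : ℝ) + 1))) := setLIntegral_le_lintegral _ _
    _ = _ := by
        rw [← ofReal_integral_eq_lintegral_ofReal (hI.const_mul _), integral_const_mul]
        · congr 1; ring
        · exact Filter.Eventually.of_forall fun x => by positivity

lemma hor_big (Ψ : 𝓢(X, ℂ)) : ∃ C : ℝ, 0 ≤ C ∧ ∀ y : X, y ≠ 0 →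
    ∫⁻ x in {x | 2 * ‖y‖ ≤ ‖x‖}, ‖Ψ (x - y) - Ψ x‖ₑ ≤ ENNReal.ofReal (C * (1 / ‖y‖)) := by
  have hI : Integrable (fun x : X => ‖x‖ * ‖Ψ x‖) := by
    simpa using Ψ.integrable_pow_mul volume 1
  have hI0 : 0 ≤ ∫ x : X, ‖x‖ * ‖Ψ x‖ := integral_nonneg fun x => by positivity
  refine ⟨2 * ∫ x : X, ‖x‖ * ‖Ψ x‖, by positivity, fun y hy => ?_⟩
  have hy' : 0 < ‖y‖ := norm_pos_iff.2 hy
  have hms : MeasurableSet {x : X | 2 * ‖y‖ ≤ ‖x‖} := measurableSet_le (by fun_prop) (by fun_prop)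
  have hI1 : Integrable (fun x : X => ‖x - y‖ * ‖Ψ (x - y)‖) := hI.comp_sub_right y
  calc ∫⁻ x in {x | 2 * ‖y‖ ≤ ‖x‖}, ‖Ψ (x - y) - Ψ x‖ₑ
      ≤ ∫⁻ x in {x : X | 2 * ‖y‖ ≤ ‖x‖},
          ENNReal.ofReal ((1 / ‖y‖) * (‖x - y‖ * ‖Ψ (x - y)‖ + ‖x‖ * ‖Ψ x‖)) := by
        apply setLIntegral_mono' hms
        intro x hx
        rw [Set.mem_ofPred_eq] at hx
        rw [← ofReal_norm]
        apply ENNReal.ofReal_le_ofReal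
        rw [one_div, inv_mul_eq_div, le_div_iff₀ hy']
        have h1 : ‖y‖ ≤ ‖x - y‖ := by linarith [norm_sub_norm_le x y]
        have h2 := norm_sub_le (Ψ (x - y)) (Ψ x)
        have h3 : ‖y‖ ≤ ‖x‖ := by linarith
        calc ‖Ψ (x - y) - Ψ x‖ * ‖y‖ ≤ (‖Ψ (x - y)‖ + ‖Ψ x‖) * ‖y‖ := by gcongr
          _ = ‖y‖ * ‖Ψ (x - y)‖ + ‖y‖ * ‖Ψ x‖ := by ring
          _ ≤ _ := by gcongr
    _ ≤ ∫⁻ x : X, ENNReal.ofReal ((1 / ‖y‖) * (‖x - y‖ * ‖Ψ (x - y)‖ + ‖x‖ * ‖Ψ x‖)) :=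
        setLIntegral_le_lintegral _ _
    _ = _ := by
        have hI2 : Integrable (fun x : X => (1 / ‖y‖) * (‖x - y‖ * ‖Ψ (x - y)‖ + ‖x‖ * ‖Ψ x‖)) :=
          (hI1.add hI).const_mul _
        rw [← ofReal_integral_eq_lintegral_ofReal hI2, integral_const_mul,
          integral_add hI1 hI, integral_sub_right_eq_self (fun x : X => ‖x‖ * ‖Ψ x‖) y]
        · congr 1; ring
        · exact Filter.Eventually.of_forall fun x => by positivity

lemma hor_min (Ψ : 𝓢(X, ℂ)) : ∃ C : ℝ, 0 ≤ C ∧ ∀ y : X, y ≠ 0 →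
    ∫⁻ x in {x | 2 * ‖y‖ ≤ ‖x‖}, ‖Ψ (x - y) - Ψ x‖ₑ ≤ ENNReal.ofReal (C * min ‖y‖ (1 / ‖y‖)) := by
  obtain ⟨C1, h1, H1⟩ := hor_small Ψ
  obtain ⟨C2, h2, H2⟩ := hor_big Ψ
  refine ⟨max C1 C2, le_max_of_le_left h1, fun y hy => ?_⟩
  rcases min_choice ‖y‖ (1 / ‖y‖) with h | h <;> rw [h]
  · refine (H1 y).trans (ENNReal.ofReal_le_ofReal ?_)
    gcongr; exact le_max_left _ _
  · refine (H2 y hy).trans (ENNReal.ofReal_le_ofReal ?_)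
    gcongr; exact le_max_right _ _

lemma geom_min (M : ℕ) : ∀ r : ℝ, 0 < r →
    ∑ j ∈ Finset.range M, min (2 ^ j * r) (1 / (2 ^ j * r)) ≤ if r < 1 then 4 - r else 2 / r := by
  induction M with
  | zero => intro r hr; simp; split_ifs <;> [linarith; positivity]
  | succ M ih =>
    intro r hr
    rw [Finset.sum_range_succ']
    have h1 := ih (2 * r) (by positivity)
    have h2 : ∑ j ∈ Finset.range M, min (2 ^ (j + 1) * r) (1 / (2 ^ (j + 1) * r)) =
        ∑ j ∈ Finset.range M, min (2 ^ j * (2 * r)) (1 / (2 ^ j * (2 * r))) := by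
      apply Finset.sum_congr rfl; intro j _; rw [pow_succ, mul_assoc]
    rw [h2]
    simp only [pow_zero, one_mul]
    have e1 := min_le_left r (1 / r)
    have e2 := min_le_right r (1 / r)
    by_cases hr1 : r < 1
    · rw [if_pos hr1]
      by_cases hr2 : 2 * r < 1
      · rw [if_pos hr2] at h1; linarith
      · rw [if_neg hr2] at h1
        have : 2 / (2 * r) ≤ 4 - 2 * r := by
          rw [div_le_iff₀ (by positivity)]; nlinarith
        linarith
    · rw [if_neg hr1]
      rw [if_neg (by linarith)] at h1
      have : 2 / (2 * r) + 1 / r = 2 / r := by field_simp; norm_num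
      linarith

lemma geom_min' (M : ℕ) (r : ℝ) (hr : 0 < r) :
    ∑ j ∈ Finset.range M, min (2 ^ j * r) (1 / (2 ^ j * r)) ≤ 4 := by
  refine (geom_min M r hr).trans ?_
  split_ifs with h
  · linarith
  · rw [div_le_iff₀ hr]; linarith

lemma hor_scale (Ψ : X → ℂ) {t : ℝ} (ht : 0 < t) (y : X) :
    ∫⁻ x in {x | 2 * ‖y‖ ≤ ‖x‖}, ‖((t ^ n : ℝ) : ℂ) * Ψ (t • (x - y)) - ((t ^ n : ℝ) : ℂ) * Ψ (t • x)‖ₑ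
      = ∫⁻ x in {x | 2 * ‖t • y‖ ≤ ‖x‖}, ‖Ψ (x - t • y) - Ψ x‖ₑ := by
  have hms : ∀ y : X, MeasurableSet {x : X | 2 * ‖y‖ ≤ ‖x‖} := fun y =>
      measurableSet_le (by fun_prop) (by fun_prop)
  set F : X → ℝ≥0∞ := {x : X | 2 * ‖t • y‖ ≤ ‖x‖}.indicator (fun x => ‖Ψ (x - t • y) - Ψ x‖ₑ) with hF
  have hme : MeasurableEmbedding (fun x : X => t • x) :=
    (Homeomorph.smulOfNeZero t ht.ne').measurableEmbedding
  have h1 : ∫⁻ x, F (t • x) = ENNReal.ofReal ((t ^ n)⁻¹) * ∫⁻ x, F x := by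
    rw [← hme.lintegral_map, Measure.map_addHaar_smul _ ht.ne', lintegral_smul_measure]
    simp [abs_of_pos (pow_pos ht n)]
  rw [← lintegral_indicator (hms _), ← lintegral_indicator (hms _), ← hF]
  have h2 : ∫⁻ x, F x = ENNReal.ofReal (t ^ n) * ∫⁻ x, F (t • x) := by
    rw [h1, ← mul_assoc, ← ENNReal.ofReal_mul (by positivity), mul_inv_cancel₀ (by positivity)]
    simp
  rw [h2, ← lintegral_const_mul' _ _ ENNReal.ofReal_ne_top]
  congr 1; ext x
  simp only [hF, Set.indicator_apply, Set.mem_ofPred_eq]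
  have : (2 * ‖y‖ ≤ ‖x‖) ↔ (2 * ‖t • y‖ ≤ ‖t • x‖) := by
    rw [norm_smul, norm_smul, Real.norm_of_nonneg ht.le, ← mul_assoc, mul_comm 2 t, mul_assoc,
      mul_le_mul_iff_right₀ ht]
  simp only [← this]
  split_ifs
  · rw [← mul_sub, enorm_mul, smul_sub]
    congr 1
    rw [← ofReal_norm, Complex.norm_real, Real.norm_of_nonneg (by positivity)]
  · simp

theorem hor_sum (Ψ : 𝓢(X, ℂ)) : ∃ C : ℝ, 0 ≤ C ∧ ∀ (M : ℕ) (s : ℝ), 0 < s → ∀ y : X,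
    ∫⁻ x in {x | 2 * ‖y‖ ≤ ‖x‖},
      ‖(∑ j ∈ Finset.range M, (((2 ^ j * s) ^ n : ℝ) : ℂ) * Ψ ((2 ^ j * s) • (x - y))) -
        ∑ j ∈ Finset.range M, (((2 ^ j * s) ^ n : ℝ) : ℂ) * Ψ ((2 ^ j * s) • x)‖ₑ
      ≤ ENNReal.ofReal C := by
  obtain ⟨C, hC, H⟩ := hor_min Ψ
  refine ⟨C * 4, by positivity, fun M s hs y => ?_⟩
  rcases eq_or_ne y 0 with rfl | hy
  · simp
  have hy' : 0 < ‖y‖ := norm_pos_iff.2 hy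
  calc _ ≤ ∫⁻ x in {x | 2 * ‖y‖ ≤ ‖x‖}, ∑ j ∈ Finset.range M,
      ‖(((2 ^ j * s) ^ n : ℝ) : ℂ) * Ψ ((2 ^ j * s) • (x - y)) -
        (((2 ^ j * s) ^ n : ℝ) : ℂ) * Ψ ((2 ^ j * s) • x)‖ₑ := by
        apply lintegral_mono; intro x
        simp only
        rw [← Finset.sum_sub_distrib]
        exact enorm_sum_le _ _
    _ = ∑ j ∈ Finset.range M, ∫⁻ x in {x | 2 * ‖y‖ ≤ ‖x‖},
      ‖(((2 ^ j * s) ^ n : ℝ) : ℂ) * Ψ ((2 ^ j * s) • (x - y)) -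
        (((2 ^ j * s) ^ n : ℝ) : ℂ) * Ψ ((2 ^ j * s) • x)‖ₑ := by
        apply lintegral_finsetSum
        intro j _
        have := Ψ.continuous
        exact (by fun_prop : Continuous fun x : X => (((2 ^ j * s) ^ n : ℝ) : ℂ) * Ψ ((2 ^ j * s) • (x - y)) -
          (((2 ^ j * s) ^ n : ℝ) : ℂ) * Ψ ((2 ^ j * s) • x)).enorm.measurable
    _ ≤ ∑ j ∈ Finset.range M, ENNReal.ofReal (C * min (2 ^ j * (s * ‖y‖)) (1 / (2 ^ j * (s * ‖y‖)))) := by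
        apply Finset.sum_le_sum
        intro j _
        have ht : (0 : ℝ) < 2 ^ j * s := by positivity
        rw [hor_scale Ψ ht y]
        have := H ((2 ^ j * s) • y) (smul_ne_zero ht.ne' hy)
        refine this.trans (le_of_eq ?_)
        rw [norm_smul, Real.norm_of_nonneg ht.le, mul_assoc]
    _ ≤ _ := by
        rw [← ENNReal.ofReal_sum_of_nonneg (fun j _ => by positivity), ← Finset.mul_sum]
        apply ENNReal.ofReal_le_ofReal
        gcongr
        exact geom_min' M _ (by positivity)

end P7
end CZ

namespace CZ
open scoped ENNReal NNReal FourierTransform SchwartzMap ContDiff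

section P8
variable {n : ℕ}

local notation "X" => EuclideanSpace ℝ (Fin n)

structure IsMult (m : EuclideanSpace ℝ (Fin n) → ℂ) (M : ℝ) : Prop where
  smooth : ∀ ξ, ξ ≠ 0 → ContDiffAt ℝ ∞ m ξ
  hom : ∀ (t : ℝ) ξ, 0 < t → m (t • ξ) = m ξ
  bdd : ∀ ξ, ‖m ξ‖ ≤ M

/-- cut-off -/
def chi (n : ℕ) : ContDiffBump (0 : EuclideanSpace ℝ (Fin n)) := ⟨1, 2, by norm_num, by norm_num⟩

lemma chi_one {x : X} (hx : ‖x‖ ≤ 1) : chi n x = 1 :=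
  (chi n).one_of_mem_closedBall (by simpa [chi] using hx)

lemma chi_zero {x : X} (hx : 2 ≤ ‖x‖) : chi n x = 0 :=
  (chi n).zero_of_le_dist (by simpa [chi] using hx)

def GG (m : X → ℂ) (a b : ℝ) (ξ : X) : ℂ := m ξ * ((chi n (a⁻¹ • ξ) - chi n (b⁻¹ • ξ) : ℝ) : ℂ)

variable {m : EuclideanSpace ℝ (Fin n) → ℂ} {M : ℝ}

lemma GG_contDiff (h : IsMult m M) {a b : ℝ} (ha : 0 < a) (hb : 0 < b) :
    ContDiff ℝ ∞ (GG m a b) := by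
  rw [contDiff_iff_contDiffAt]
  intro ξ
  rcases eq_or_ne ξ 0 with rfl | hξ
  · have : GG m a b =ᶠ[nhds 0] fun _ => (0 : ℂ) := by
      filter_upwards [Metric.ball_mem_nhds (0 : X) (lt_min ha hb)] with x hx
      rw [mem_ball_zero_iff, lt_min_iff] at hx
      unfold GG
      rw [chi_one, chi_one]
      · simp
      · rw [norm_smul, Real.norm_of_nonneg (by positivity), inv_mul_le_iff₀ hb]; linarith
      · rw [norm_smul, Real.norm_of_nonneg (by positivity), inv_mul_le_iff₀ ha]; linarith
    exact contDiffAt_const.congr_of_eventuallyEq this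
  · unfold GG
    refine (h.smooth ξ hξ).mul ?_
    have hc : ∀ c : ℝ, ContDiff ℝ ∞ fun ξ : X => chi n (c • ξ) := fun c =>
      (chi n).contDiff.comp (contDiff_const_smul c)
    have := (Complex.ofRealCLM.contDiff (n := ∞)).comp ((hc a⁻¹).sub (hc b⁻¹))
    exact this.contDiffAt

lemma GG_supp {a b : ℝ} (ha : 0 < a) (hb : 0 < b) : HasCompactSupport (GG m a b) := by
  apply HasCompactSupport.intro (isCompact_closedBall (0 : X) (2 * max a b))
  intro x hx
  rw [mem_closedBall_zero_iff, not_le] at hx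
  unfold GG
  rw [chi_zero, chi_zero]
  · simp
  · rw [norm_smul, Real.norm_of_nonneg (by positivity), le_inv_mul_iff₀ hb]
    nlinarith [le_max_right a b]
  · rw [norm_smul, Real.norm_of_nonneg (by positivity), le_inv_mul_iff₀ ha]
    nlinarith [le_max_left a b]

/-- truncated multiplier as a Schwartz function -/
def GS (h : IsMult m M) {a b : ℝ} (ha : 0 < a) (hb : 0 < b) : 𝓢(X, ℂ) :=
  (GG_supp (m := m) ha hb).toSchwartzMap (GG_contDiff h ha hb)

lemma GS_apply (h : IsMult m M) {a b : ℝ} (ha : 0 < a) (hb : 0 < b) (ξ : X) :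
    GS h ha hb ξ = GG m a b ξ := rfl

lemma GG_bound (h : IsMult m M) (a b : ℝ) (ξ : X) : ‖GG m a b ξ‖ ≤ M := by
  unfold GG
  rw [norm_mul, Complex.norm_real]
  have h1 : ‖chi n (a⁻¹ • ξ) - chi n (b⁻¹ • ξ)‖ ≤ 1 := by
    rw [Real.norm_eq_abs, abs_le]
    constructor <;> linarith [(chi n).nonneg (x := a⁻¹ • ξ), (chi n).nonneg (x := b⁻¹ • ξ),
      (chi n).le_one (x := a⁻¹ • ξ), (chi n).le_one (x := b⁻¹ • ξ)]
  calc _ ≤ M * 1 := mul_le_mul (h.bdd ξ) h1 (norm_nonneg _) ((norm_nonneg _).trans (h.bdd ξ))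
    _ = M := mul_one _

lemma GG_sum (h : IsMult m M) (N : ℕ) {s : ℝ} (hs : 0 < s) (ξ : X) :
    GG m (2 ^ N * s) s ξ = ∑ j ∈ Finset.range N, GG m 2 1 ((2 ^ j * s)⁻¹ • ξ) := by
  induction N with
  | zero => simp [GG]
  | succ N ih =>
    rw [Finset.sum_range_succ, ← ih]
    unfold GG
    rw [h.hom _ _ (by positivity), smul_smul, smul_smul, ← mul_add]
    congr 1
    have e1 : (2 : ℝ)⁻¹ * (2 ^ N * s)⁻¹ = (2 ^ (N + 1) * s)⁻¹ := by
      rw [← mul_inv]; congr 1; ring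
    rw [e1, inv_one, one_mul]
    push_cast; ring

lemma fourierInv_scale (g : X → ℂ) {t : ℝ} (ht : 0 < t) (x : X) :
    𝓕⁻ (fun ξ => g (t⁻¹ • ξ)) x = ((t ^ n : ℝ) : ℂ) * 𝓕⁻ g (t • x) := by
  rw [Real.fourierInv_eq', Real.fourierInv_eq']
  have := Measure.integral_comp_inv_smul (volume : Measure X)
    (fun ξ => Complex.exp (((2 * Real.pi * inner ℝ ξ (t • x) : ℝ) : ℂ) * Complex.I) • g ξ) t
  rw [abs_of_pos (by positivity)] at this
  simp only [finrank_euclideanSpace, Fintype.card_fin] at this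
  rw [← Complex.real_smul, ← this]
  congr 1; ext ξ
  congr 5
  rw [inner_smul_left, inner_smul_right]
  simp [ht.ne']

lemma kernel_formula (h : IsMult m M) (N : ℕ) {s : ℝ} (hs : 0 < s) (x : X) :
    (𝓕⁻ (GS h (show 0 < 2 ^ N * s by positivity) hs) : 𝓢(X, ℂ)) x =
      ∑ j ∈ Finset.range N, (((2 ^ j * s) ^ n : ℝ) : ℂ) *
        (𝓕⁻ (GS h two_pos one_pos) : 𝓢(X, ℂ)) ((2 ^ j * s) • x) := by
  have e : ∀ j ∈ Finset.range N, (((2 ^ j * s) ^ n : ℝ) : ℂ) *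
        (𝓕⁻ (GS h two_pos one_pos) : 𝓢(X, ℂ)) ((2 ^ j * s) • x) =
      𝓕⁻ (fun ξ => GG m 2 1 ((2 ^ j * s)⁻¹ • ξ)) x := by
    intro j _
    rw [fourierInv_scale _ (by positivity), SchwartzMap.fourierInv_coe]
    rfl
  rw [Finset.sum_congr rfl e, SchwartzMap.fourierInv_coe]
  simp_rw [Real.fourierInv_eq']
  rw [← integral_finsetSum]
  · congr 1; ext ξ
    rw [GS_apply, GG_sum h N hs, Finset.smul_sum]
  · intro j _
    have hi : Integrable fun ξ : X => GG m 2 1 ((2 ^ j * s)⁻¹ • ξ) :=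
      (GS h two_pos one_pos).integrable.comp_smul (by positivity)
    refine hi.bdd_mul (c := 1) (Continuous.aestronglyMeasurable (by fun_prop)) ?_
    refine Filter.Eventually.of_forall fun ξ => ?_
    rw [Complex.norm_exp_ofReal_mul_I]

theorem exists_CZ (h : IsMult m M) : ∃ B : ℝ≥0∞, B ≠ ⊤ ∧ ∀ (N : ℕ) (s : ℝ) (hs : 0 < s),
    IsCZ (𝓕⁻ (GS h (show 0 < 2 ^ N * s by positivity) hs) : 𝓢(X, ℂ)) B := by
  obtain ⟨C, hC, H⟩ := hor_sum (𝓕⁻ (GS h two_pos one_pos) : 𝓢(X, ℂ))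
  refine ⟨ENNReal.ofReal (M ^ 2) + ENNReal.ofReal C, by finiteness, fun N s hs => ?_⟩
  refine ⟨SchwartzMap.continuous _, ⟨_, SchwartzMap.norm_le_seminorm ℝ _⟩, ?_, ?_⟩
  · intro f hf hf2
    refine (l2_bound _ (M := M) ?_ f hf hf2).trans ?_
    · intro ξ; exact GG_bound h _ _ ξ
    · gcongr; exact le_self_add
  · intro y
    simp_rw [kernel_formula h N hs]
    exact (H N s hs y).trans le_add_self

lemma T_eq_fourierInv (g f : 𝓢(X, ℂ)) (x : X) :
    T (𝓕⁻ g : 𝓢(X, ℂ)) f x = 𝓕⁻ (fun ξ => g ξ * 𝓕 (f : X → ℂ) ξ) x := by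
  rw [T_eq_convolution]
  conv_lhs => rw [← FourierTransform.fourierInv_fourier_eq (F := 𝓢(X, ℂ))
    (SchwartzMap.convolution (ContinuousLinearMap.mul ℂ ℂ) f (𝓕⁻ g))]
  rw [SchwartzMap.fourierInv_coe]
  have e : (fun ξ => g ξ * 𝓕 (f : X → ℂ) ξ) =
      ⇑(𝓕 (SchwartzMap.convolution (ContinuousLinearMap.mul ℂ ℂ) f (𝓕⁻ g)) : 𝓢(X, ℂ)) := by
    ext ξ
    rw [fourier_T]; rfl
  rw [e]

lemma GG_tendsto (m : X → ℂ) {ξ : X} (hξ : ξ ≠ 0) :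
    ∀ᶠ N : ℕ in Filter.atTop, GG m (2 ^ (2 * N) * (2 ^ N)⁻¹) (2 ^ N)⁻¹ ξ = m ξ := by
  have hξ' : 0 < ‖ξ‖ := norm_pos_iff.2 hξ
  have ht : Filter.Tendsto (fun N : ℕ => (2 : ℝ) ^ N) Filter.atTop Filter.atTop :=
    tendsto_pow_atTop_atTop_of_one_lt (by norm_num)
  filter_upwards [ht.eventually_ge_atTop ‖ξ‖, ht.eventually_ge_atTop (2 / ‖ξ‖)] with N h1 h2
  have e : (2 : ℝ) ^ (2 * N) * (2 ^ N)⁻¹ = 2 ^ N := by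
    rw [two_mul, pow_add]; field_simp
  unfold GG
  rw [e, inv_inv, chi_one, chi_zero]
  · simp
  · rw [norm_smul, Real.norm_of_nonneg (by positivity)]
    rwa [div_le_iff₀ hξ'] at h2
  · rw [norm_smul, Real.norm_of_nonneg (by positivity), inv_mul_le_iff₀ (by positivity)]
    linarith

lemma IsMult.aesm (hn : 1 ≤ n) (h : IsMult m M) : AEStronglyMeasurable m volume := by
  have : Nonempty (Fin n) := ⟨⟨0, hn⟩⟩
  have hc : ContinuousOn m ({0}ᶜ : Set X) := fun ξ hξ => (h.smooth ξ hξ).continuousAt.continuousWithinAt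
  have h1 := hc.aestronglyMeasurable (μ := volume) (MeasurableSet.compl (measurableSet_singleton _))
  rwa [Measure.restrict_eq_self_of_ae_mem] at h1
  exact compl_mem_ae_iff.2 (measure_singleton _)

theorem multiplier (hn : 1 ≤ n) (h : IsMult m M) {p : ℝ} (hp : 1 < p) :
    ∃ C : ℝ≥0∞, C ≠ ⊤ ∧ ∀ f : X → ℂ, ContDiff ℝ ∞ f → HasCompactSupport f →
      ∫⁻ x, ‖𝓕⁻ (fun ξ => m ξ * 𝓕 f ξ) x‖ₑ ^ p ≤ C * ∫⁻ x, ‖f x‖ₑ ^ p := by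
  obtain ⟨B, hB, H⟩ := exists_CZ h
  refine ⟨CP n p B, CP_ne_top hp hB, fun f hf hc => ?_⟩
  have : Nonempty (Fin n) := ⟨⟨0, hn⟩⟩
  set fS : 𝓢(X, ℂ) := hc.toSchwartzMap hf with hfS
  have hs : ∀ N : ℕ, (0 : ℝ) < (2 ^ N)⁻¹ := fun N => by positivity
  set g : ℕ → 𝓢(X, ℂ) := fun N =>
    GS h (show (0 : ℝ) < 2 ^ (2 * N) * (2 ^ N)⁻¹ by positivity) (hs N) with hg
  have hb : ∀ N, ∫⁻ x, ‖T (𝓕⁻ (g N) : 𝓢(X, ℂ)) f x‖ₑ ^ p ≤ CP n p B * ∫⁻ x, ‖f x‖ₑ ^ p := fun N =>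
    strong hn (H (2 * N) _ (hs N)) (H (2 * N) _ (hs N)).refl hf.continuous hc hp
  have hfi : Integrable (𝓕 f) := (𝓕 fS).integrable
  have hpt : ∀ x, Filter.Tendsto (fun N => T (𝓕⁻ (g N) : 𝓢(X, ℂ)) f x) Filter.atTop
      (nhds (𝓕⁻ (fun ξ => m ξ * 𝓕 f ξ) x)) := by
    intro x
    have e : ∀ N, T (𝓕⁻ (g N) : 𝓢(X, ℂ)) f x = 𝓕⁻ (fun ξ => g N ξ * 𝓕 f ξ) x := fun N =>
      T_eq_fourierInv (g N) fS x
    simp_rw [e, Real.fourierInv_eq']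
    apply tendsto_integral_of_dominated_convergence (fun ξ => M * ‖𝓕 f ξ‖)
    · intro N
      have h1 := (g N).continuous
      have h2 : Continuous (𝓕 f) := (𝓕 fS).continuous
      exact Continuous.aestronglyMeasurable (by fun_prop)
    · exact hfi.norm.const_mul M
    · intro N
      refine Filter.Eventually.of_forall fun ξ => ?_
      rw [norm_smul, Complex.norm_exp_ofReal_mul_I, one_mul, norm_mul]
      gcongr
      exact GG_bound h _ _ ξ
    · have : ∀ᵐ ξ : X, ξ ≠ 0 := compl_mem_ae_iff.2 (measure_singleton _)
      filter_upwards [this] with ξ hξ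
      apply tendsto_const_nhds.congr'
      filter_upwards [GG_tendsto m hξ] with N hN
      rw [hg]; simp only
      rw [GS_apply, hN]
  have hm : ∀ N, Measurable fun x => ‖T (𝓕⁻ (g N) : 𝓢(X, ℂ)) f x‖ₑ ^ p := by
    intro N
    exact ((continuous_T (H (2 * N) _ (hs N))
      (hf.continuous.integrable_of_hasCompactSupport hc)).enorm.measurable).pow_const p
  calc ∫⁻ x, ‖𝓕⁻ (fun ξ => m ξ * 𝓕 f ξ) x‖ₑ ^ p
      = ∫⁻ x, Filter.liminf (fun N => ‖T (𝓕⁻ (g N) : 𝓢(X, ℂ)) f x‖ₑ ^ p) Filter.atTop := by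
        congr 1; ext x
        exact ((ENNReal.continuous_rpow_const.tendsto _).comp (hpt x).enorm).liminf_eq.symm
    _ ≤ Filter.liminf (fun N => ∫⁻ x, ‖T (𝓕⁻ (g N) : 𝓢(X, ℂ)) f x‖ₑ ^ p) Filter.atTop :=
        lintegral_liminf_le hm
    _ ≤ Filter.liminf (fun _ : ℕ => CP n p B * ∫⁻ x, ‖f x‖ₑ ^ p) Filter.atTop :=
        Filter.liminf_le_liminf (Filter.Eventually.of_forall hb)
    _ = _ := Filter.liminf_const _

end P8
end CZ

namespace CZ
open scoped ENNReal NNReal FourierTransform SchwartzMap ContDiff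

section P9
variable {n : ℕ}

local notation "X" => EuclideanSpace ℝ (Fin n)

/-- test functions -/
structure TF {W : Type*} [NormedAddCommGroup W] [NormedSpace ℝ W]
    (u : EuclideanSpace ℝ (Fin n) → W) : Prop where
  smooth : ContDiff ℝ ∞ u
  supp : HasCompactSupport u

variable {W W' : Type*} [NormedAddCommGroup W] [NormedSpace ℝ W]
  [NormedAddCommGroup W'] [NormedSpace ℝ W']

lemma TF.pd {u : X → W} (h : TF u) (i : Fin n) : TF (pd i u) where
  smooth := by
    have h1 : ContDiff ℝ ∞ (fderiv ℝ u) := h.smooth.fderiv_right (by simp)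
    exact h1.clm_apply contDiff_const
  supp := by
    exact (h.supp.fderiv (𝕜 := ℝ)).comp_left
      (g := fun L : X →L[ℝ] W => L (EuclideanSpace.single i 1)) rfl

lemma TF.clm {u : X → W} (h : TF u) (L : W →L[ℝ] W') : TF (fun x => L (u x)) where
  smooth := L.contDiff.comp h.smooth
  supp := h.supp.comp_left (map_zero L)

lemma TF.sum {ι : Type*} {s : Finset ι} {u : ι → X → W} (h : ∀ i ∈ s, TF (u i)) :
    TF (fun x => ∑ i ∈ s, u i x) := by
  classical
  induction s using Finset.induction_on with
  | empty => simpa using ⟨contDiff_const, HasCompactSupport.zero⟩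
  | insert a s ha ih =>
    simp only [Finset.sum_insert ha]
    have h1 := h a (Finset.mem_insert_self _ _)
    have h2 := ih fun i hi => h i (Finset.mem_insert_of_mem hi)
    exact ⟨h1.smooth.add h2.smooth, h1.supp.add h2.supp⟩

lemma pd_clm {u : X → W} (h : TF u) (L : W →L[ℝ] W') (i : Fin n) :
    pd i (fun x => L (u x)) = fun x => L (pd i u x) := by
  ext x
  unfold _root_.pd
  have : DifferentiableAt ℝ u x := (h.smooth.differentiable (by simp)) x
  rw [show (fun x => L (u x)) = L ∘ u from rfl, fderiv_comp x L.differentiableAt this]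
  simp

lemma TF.pd_iter {u : X → W} (h : TF u) (i : Fin n) (r : ℕ) : TF ((_root_.pd i)^[r] u) := by
  induction r with
  | zero => exact h
  | succ r ih => rw [Function.iterate_succ_apply']; exact ih.pd i

lemma pd_iter_clm {u : X → W} (h : TF u) (L : W →L[ℝ] W') (i : Fin n) (r : ℕ) :
    (pd i)^[r] (fun x => L (u x)) = fun x => L ((pd i)^[r] u x) := by
  induction r with
  | zero => rfl
  | succ r ih =>
    rw [Function.iterate_succ_apply', ih, Function.iterate_succ_apply', pd_clm (h.pd_iter i r)]

lemma TF.pdList {u : X → W} (h : TF u) (α : Fin n → ℕ) (l : List (Fin n)) :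
    TF (l.foldr (fun i v => (_root_.pd i)^[α i] v) u) := by
  induction l with
  | nil => exact h
  | cons a l ih => exact ih.pd_iter a _

lemma pdList_clm {u : X → W} (h : TF u) (L : W →L[ℝ] W') (α : Fin n → ℕ) (l : List (Fin n)) :
    l.foldr (fun i v => (pd i)^[α i] v) (fun x => L (u x)) =
      fun x => L (l.foldr (fun i v => (pd i)^[α i] v) u x) := by
  induction l with
  | nil => rfl
  | cons a l ih => rw [List.foldr_cons, ih, pd_iter_clm (h.pdList α l)]; rfl

lemma TF.pdMulti {u : X → W} (h : TF u) (α : Fin n → ℕ) : TF (pdMulti α u) := h.pdList α _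

lemma pdMulti_clm {u : X → W} (h : TF u) (L : W →L[ℝ] W') (α : Fin n → ℕ) :
    pdMulti α (fun x => L (u x)) = fun x => L (pdMulti α u x) := pdList_clm h L α _

/-- Schwartz function from a test function -/
def TF.sch {u : X → ℂ} (h : TF u) : 𝓢(X, ℂ) := h.supp.toSchwartzMap h.smooth

lemma TF.fourier_integrable {u : X → ℂ} (h : TF u) : Integrable (𝓕 u) := (𝓕 h.sch).integrable

lemma TF.inv {u : X → ℂ} (h : TF u) (x : X) : u x = 𝓕⁻ (𝓕 u) x := by
  have := congrArg (fun f : 𝓢(X, ℂ) => f x)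
    (FourierTransform.fourierInv_fourier_eq (F := 𝓢(X, ℂ)) h.sch)
  simp only [SchwartzMap.fourierInv_coe] at this
  exact this.symm

lemma fourier_pd {u : X → ℂ} (h : TF u) (i : Fin n) (ξ : X) :
    𝓕 (pd i u) ξ = (2 * Real.pi * Complex.I) * (ξ i : ℂ) * 𝓕 u ξ := by
  have := congrArg (fun f : 𝓢(X, ℂ) => f ξ)
    (SchwartzMap.fourier_lineDerivOp_eq h.sch (EuclideanSpace.single i 1))
  have hT : (fun x : X => inner ℝ x (EuclideanSpace.single i (1 : ℝ))).HasTemperateGrowth :=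
    ((innerSL ℝ).flip (EuclideanSpace.single i (1 : ℝ))).hasTemperateGrowth
  simp only [smul_apply, SchwartzMap.smulLeftCLM_apply_apply hT] at this
  refine Eq.trans ?_ (this.trans ?_)
  · rfl
  · rw [EuclideanSpace.inner_single_right]
    simp only [smul_eq_mul, Complex.real_smul, mul_assoc]
    simp
    exact Or.inl rfl

lemma fourier_pd_iter {u : X → ℂ} (h : TF u) (i : Fin n) (r : ℕ) (ξ : X) :
    𝓕 ((pd i)^[r] u) ξ = ((2 * Real.pi * Complex.I) * (ξ i : ℂ)) ^ r * 𝓕 u ξ := by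
  induction r with
  | zero => simp
  | succ r ih =>
    rw [Function.iterate_succ_apply', fourier_pd (h.pd_iter i r), ih]; ring

lemma fourier_pdList {u : X → ℂ} (h : TF u) (α : Fin n → ℕ) (l : List (Fin n)) (ξ : X) :
    𝓕 (l.foldr (fun i v => (pd i)^[α i] v) u) ξ =
      (l.map fun i => ((2 * Real.pi * Complex.I) * (ξ i : ℂ)) ^ α i).prod * 𝓕 u ξ := by
  induction l with
  | nil => simp
  | cons a l ih =>
    rw [List.foldr_cons, fourier_pd_iter (h.pdList α l), ih, List.map_cons, List.prod_cons]; ring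

lemma fourier_pdMulti {u : X → ℂ} (h : TF u) (α : Fin n → ℕ) (ξ : X) :
    𝓕 (pdMulti α u) ξ = (2 * Real.pi * Complex.I) ^ (∑ i, α i) * (((∏ i, ξ i ^ α i : ℝ)) : ℂ) *
      𝓕 u ξ := by
  unfold _root_.pdMulti
  rw [fourier_pdList h, ← List.ofFn_eq_map, List.prod_ofFn]
  have e : ∀ i, (2 * Real.pi * Complex.I * (ξ i : ℂ)) ^ α i =
      (2 * Real.pi * Complex.I) ^ α i * (ξ i : ℂ) ^ α i := fun i => mul_pow _ _ _
  simp_rw [e]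
  rw [Finset.prod_mul_distrib, Finset.prod_pow_eq_pow_sum]
  push_cast; rfl

/-- iterated derivative in coordinate directions -/
def ds {k : ℕ} (s : Fin k → Fin n) (u : X → W) : X → W :=
  fun x => iteratedFDeriv ℝ k u x fun l => EuclideanSpace.single (s l) 1

lemma ds_zero (s : Fin 0 → Fin n) (u : X → W) : ds s u = u := by
  ext x; simp [ds]

lemma ds_succ {k : ℕ} (s : Fin (k + 1) → Fin n) {u : X → W} (h : TF u) :
    ds s u = pd (s 0) (ds (Fin.tail s) u) := by
  ext x
  unfold ds _root_.pd
  rw [iteratedFDeriv_succ_apply_left, fderiv_continuousMultilinear_apply_const_apply]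
  · rfl
  · exact (h.smooth.differentiable_iteratedFDeriv (by exact_mod_cast ENat.natCast_lt_top k)) x

lemma TF.ds {k : ℕ} (s : Fin k → Fin n) {u : X → W} (h : TF u) : TF (ds s u) := by
  induction k with
  | zero => rw [ds_zero]; exact h
  | succ k ih => rw [ds_succ s h]; exact (ih _).pd _

lemma ds_clm {k : ℕ} (s : Fin k → Fin n) {u : X → W} (h : TF u) (L : W →L[ℝ] W') :
    CZ.ds s (fun x => L (u x)) = fun x => L (CZ.ds s u x) := by
  induction k with
  | zero => simp only [ds_zero]
  | succ k ih => rw [ds_succ s h, ds_succ s (h.clm L), ih, pd_clm (h.ds _)]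

lemma fourier_ds {k : ℕ} (s : Fin k → Fin n) {u : X → ℂ} (h : TF u) (ξ : X) :
    𝓕 (CZ.ds s u) ξ = (2 * Real.pi * Complex.I) ^ k * ((∏ l, ξ (s l) : ℝ) : ℂ) * 𝓕 u ξ := by
  induction k with
  | zero => simp [ds_zero]
  | succ k ih =>
    rw [ds_succ s h, fourier_pd (h.ds _), ih, Fin.prod_univ_succ]
    push_cast; simp only [Fin.tail]; ring

lemma norm_iteratedFDeriv_le (k : ℕ) (u : X → W) (x : X) :
    ‖iteratedFDeriv ℝ k u x‖ ≤ ∑ s : Fin k → Fin n, ‖CZ.ds s u x‖ := by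
  apply ContinuousMultilinearMap.opNorm_le_bound (Finset.sum_nonneg fun _ _ => norm_nonneg _)
  intro v
  have e : v = fun l => ∑ i, (v l i) • (EuclideanSpace.single i (1 : ℝ) : X) := by
    ext l j
    simp [Finset.sum_apply, Pi.single_apply]
  have e2 : iteratedFDeriv ℝ k u x v = ∑ s : Fin k → Fin n, (∏ l, v l (s l)) • CZ.ds s u x := by
    conv_lhs => rw [e]
    rw [ContinuousMultilinearMap.map_sum]
    apply Finset.sum_congr rfl
    intro s _
    rw [ContinuousMultilinearMap.map_smul_univ]
    rfl
  rw [e2, Finset.sum_mul]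
  refine (norm_sum_le _ _).trans (Finset.sum_le_sum fun s _ => ?_)
  rw [norm_smul, mul_comm, norm_prod]
  gcongr with l _
  exact PiLp.norm_apply_le (v l) (s l)

end P9
end CZ

namespace CZ
open scoped ENNReal NNReal FourierTransform SchwartzMap ContDiff

section P10
variable {n : ℕ}

local notation "X" => EuclideanSpace ℝ (Fin n)

variable {V E : Type*} [NormedAddCommGroup V] [InnerProductSpace ℝ V] [FiniteDimensional ℝ V]
    [NormedAddCommGroup E] [InnerProductSpace ℝ E] [FiniteDimensional ℝ E]

/-- polynomial combination of operators -/
def pol {Y Z : Type*} [NormedAddCommGroup Y] [NormedSpace ℝ Y] [NormedAddCommGroup Z]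
    [NormedSpace ℝ Z] (k : ℕ) (a : (Fin n → ℕ) → (Y →L[ℝ] Z)) (ξ : X) : Y →L[ℝ] Z :=
  ∑ α ∈ Finset.Nat.antidiagonalTuple n k, (∏ i, ξ i ^ α i) • a α

lemma pol_contDiff {Y Z : Type*} [NormedAddCommGroup Y] [NormedSpace ℝ Y] [NormedAddCommGroup Z]
    [NormedSpace ℝ Z] (k : ℕ) (a : (Fin n → ℕ) → (Y →L[ℝ] Z)) : ContDiff ℝ ∞ (pol k a) := by
  unfold pol
  apply ContDiff.sum
  intro α _
  have h : ContDiff ℝ ∞ (fun ξ : X => ∏ i, ξ i ^ α i) := by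
    apply contDiff_prod
    intro i _
    apply ContDiff.pow
    exact contDiff_euclidean.1 contDiff_id i
  exact h.smul contDiff_const

lemma pol_hom {Y Z : Type*} [NormedAddCommGroup Y] [NormedSpace ℝ Y] [NormedAddCommGroup Z]
    [NormedSpace ℝ Z] (k : ℕ) (a : (Fin n → ℕ) → (Y →L[ℝ] Z)) (t : ℝ) (ξ : X) :
    pol k a (t • ξ) = t ^ k • pol k a ξ := by
  unfold pol
  rw [Finset.smul_sum]
  apply Finset.sum_congr rfl
  intro α hα
  rw [Finset.Nat.mem_antidiagonalTuple] at hα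
  rw [smul_smul]
  congr 1
  simp only [PiLp.smul_apply, smul_eq_mul, mul_pow]
  rw [Finset.prod_mul_distrib, Finset.prod_pow_eq_pow_sum, hα]

/-- the symbol as continuous linear map -/
def sg (k : ℕ) (A : (Fin n → ℕ) → (V →ₗ[ℝ] E)) (ξ : X) : V →L[ℝ] E :=
  pol k (fun α => LinearMap.toContinuousLinearMap (A α)) ξ

/-- its transpose -/
def sgt (k : ℕ) (A : (Fin n → ℕ) → (V →ₗ[ℝ] E)) (ξ : X) : E →L[ℝ] V :=
  pol k (fun α => ContinuousLinearMap.adjoint (LinearMap.toContinuousLinearMap (A α))) ξ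

lemma sg_apply (k : ℕ) (A : (Fin n → ℕ) → (V →ₗ[ℝ] E)) (ξ : X) (v : V) :
    sg k A ξ v = symb k A ξ v := by
  simp [sg, pol, symb]

lemma inner_sgt (k : ℕ) (A : (Fin n → ℕ) → (V →ₗ[ℝ] E)) (ξ : X) (v : V) (w : E) :
    inner ℝ (sgt k A ξ w) v = inner ℝ w (sg k A ξ v) := by
  simp [sg, sgt, pol, sum_inner, inner_sum, inner_smul_left, inner_smul_right,
    ContinuousLinearMap.adjoint_inner_left]

/-- left inverse of the symbol -/
def Rinv (k : ℕ) (A : (Fin n → ℕ) → (V →ₗ[ℝ] E)) (ξ : X) : E →L[ℝ] V :=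
  Ring.inverse (sgt k A ξ ∘L sg k A ξ : V →L[ℝ] V) ∘L sgt k A ξ

lemma isUnit_BB {k : ℕ} {A : (Fin n → ℕ) → (V →ₗ[ℝ] E)} {ξ : X}
    (h : Function.Injective (symb k A ξ)) : IsUnit (sgt k A ξ ∘L sg k A ξ : V →L[ℝ] V) := by
  have hinj : Function.Injective (sgt k A ξ ∘L sg k A ξ : V →L[ℝ] V) := by
    rw [injective_iff_map_eq_zero]
    intro v hv
    have h1 : inner ℝ (sg k A ξ v) (sg k A ξ v) = 0 := by
      rw [← inner_sgt]
      have : sgt k A ξ (sg k A ξ v) = 0 := hv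
      rw [this, inner_zero_left]
    rw [inner_self_eq_zero, sg_apply] at h1
    exact h (by rw [h1, map_zero])
  rw [ContinuousLinearMap.isUnit_iff_bijective]
  exact ⟨hinj, LinearMap.surjective_of_injective
    (f := (sgt k A ξ ∘L sg k A ξ : V →L[ℝ] V).toLinearMap) hinj⟩

lemma Rinv_sg {k : ℕ} {A : (Fin n → ℕ) → (V →ₗ[ℝ] E)} {ξ : X}
    (h : Function.Injective (symb k A ξ)) (v : V) : Rinv k A ξ (sg k A ξ v) = v := by
  have := Ring.inverse_mul_cancel _ (isUnit_BB h)
  exact congrArg (fun L : V →L[ℝ] V => L v) this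

lemma Rinv_contDiffAt {k : ℕ} {A : (Fin n → ℕ) → (V →ₗ[ℝ] E)} {ξ : X}
    (h : Function.Injective (symb k A ξ)) : ContDiffAt ℝ ∞ (Rinv k A) ξ := by
  have h1 : ContDiff ℝ ∞ (sg k A) := pol_contDiff _ _
  have h2 : ContDiff ℝ ∞ (sgt k A) := pol_contDiff _ _
  have h3 : ContDiff ℝ ∞ fun ξ => (sgt k A ξ ∘L sg k A ξ : V →L[ℝ] V) := h2.clm_comp h1
  have : CompleteSpace V := FiniteDimensional.complete ℝ V
  obtain ⟨U, hU⟩ := isUnit_BB h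
  have h4 : ContDiffAt ℝ ∞ (Ring.inverse : (V →L[ℝ] V) → (V →L[ℝ] V))
      (sgt k A ξ ∘L sg k A ξ : V →L[ℝ] V) := by
    rw [← hU]; exact contDiffAt_ringInverse ℝ U
  exact (h4.comp ξ h3.contDiffAt).clm_comp h2.contDiffAt

lemma Rinv_hom {k : ℕ} {A : (Fin n → ℕ) → (V →ₗ[ℝ] E)} {ξ : X}
    (h : Function.Injective (symb k A ξ)) {t : ℝ} (ht : 0 < t) :
    Rinv k A (t • ξ) = (t ^ k)⁻¹ • Rinv k A ξ := by
  have e1 : sg k A (t • ξ) = t ^ k • sg k A ξ := pol_hom _ _ _ _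
  have e2 : sgt k A (t • ξ) = t ^ k • sgt k A ξ := pol_hom _ _ _ _
  have hu := isUnit_BB h
  have htk : t ^ k ≠ 0 := by positivity
  unfold Rinv
  rw [e1, e2]
  set B : V →L[ℝ] V := sgt k A ξ ∘L sg k A ξ with hB
  have e3 : ((t ^ k • sgt k A ξ) ∘L (t ^ k • sg k A ξ) : V →L[ℝ] V) = (t ^ k * t ^ k) • B := by
    ext v; simp [hB, smul_smul]
  have e4 : Ring.inverse ((t ^ k * t ^ k) • B) = (t ^ k * t ^ k)⁻¹ • Ring.inverse B := by
    have hu2 : IsUnit ((t ^ k * t ^ k) • B) := by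
      have := hu.smul (Units.mk0 (t ^ k * t ^ k) (by positivity))
      exact this
    apply hu2.mul_left_injective
    simp only
    rw [Ring.inverse_mul_cancel _ hu2, smul_mul_smul_comm, Ring.inverse_mul_cancel _ hu,
      inv_mul_cancel₀ (by positivity), one_smul]
  rw [e3, e4]
  ext w
  simp only [ContinuousLinearMap.comp_apply, _root_.smul_apply, map_smul, smul_smul]
  congr 1
  field_simp

/-- the multiplier -/
def mul0 (k : ℕ) (A : (Fin n → ℕ) → (V →ₗ[ℝ] E)) (s : Fin k → Fin n) (v : V) (w : E) (ξ : X) : ℂ :=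
  ((∏ l, ξ (s l)) * inner ℝ v (Rinv k A ξ w) : ℝ)

lemma mul0_isMult (k : ℕ) {A : (Fin n → ℕ) → (V →ₗ[ℝ] E)}
    (hell : ∀ ξ : X, ξ ≠ 0 → Function.Injective (symb k A ξ)) (s : Fin k → Fin n) (v : V) (w : E) :
    ∃ M, IsMult (mul0 k A s v w) M := by
  have hs : ∀ ξ : X, ξ ≠ 0 → ContDiffAt ℝ ∞ (mul0 k A s v w) ξ := by
    intro ξ hξ
    have h1 : ContDiffAt ℝ ∞ (fun ξ : X => ∏ l, ξ (s l)) ξ := by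
      apply ContDiff.contDiffAt
      apply contDiff_prod
      intro i _
      exact contDiff_euclidean.1 contDiff_id (s i)
    have h2 : ContDiffAt ℝ ∞ (fun ξ : X => inner ℝ v (Rinv k A ξ w)) ξ :=
      contDiffAt_const.inner ℝ ((Rinv_contDiffAt (hell ξ hξ)).clm_apply contDiffAt_const)
    exact (Complex.ofRealCLM.contDiff (n := ∞)).contDiffAt.comp ξ (h1.mul h2)
  have hh : ∀ (t : ℝ) (ξ : X), 0 < t → mul0 k A s v w (t • ξ) = mul0 k A s v w ξ := by
    intro t ξ ht
    rcases eq_or_ne ξ 0 with rfl | hξ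
    · simp
    unfold mul0
    rw [Rinv_hom (hell ξ hξ) ht]
    congr 1
    simp only [PiLp.smul_apply, smul_eq_mul, _root_.smul_apply, inner_smul_right]
    rw [Finset.prod_mul_distrib]
    simp only [Finset.prod_const, Finset.card_univ, Fintype.card_fin]
    field_simp
  have hc : ContinuousOn (mul0 k A s v w) (Metric.sphere 0 1) := fun ξ hξ =>
    (hs ξ (ne_zero_of_mem_unit_sphere ⟨ξ, hξ⟩)).continuousAt.continuousWithinAt
  obtain ⟨C, hC⟩ := (isCompact_sphere (0 : X) 1).exists_bound_of_continuousOn hc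
  refine ⟨max C ‖mul0 k A s v w 0‖, hs, hh, fun ξ => ?_⟩
  rcases eq_or_ne ξ 0 with rfl | hξ
  · exact le_max_right _ _
  · refine le_trans ?_ (le_max_left _ _)
    rw [← hh (‖ξ‖⁻¹) ξ (by positivity)]
    apply hC
    simp [norm_smul, hξ]

end P10
end CZ

namespace CZ
open scoped ENNReal NNReal FourierTransform SchwartzMap ContDiff

section P11
variable {n : ℕ}

local notation "X" => EuclideanSpace ℝ (Fin n)

variable {V E : Type*} [NormedAddCommGroup V] [InnerProductSpace ℝ V] [FiniteDimensional ℝ V]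
    [NormedAddCommGroup E] [InnerProductSpace ℝ E] [FiniteDimensional ℝ E]

/-- complex-valued component along `v` -/
def rl {V : Type*} [NormedAddCommGroup V] [InnerProductSpace ℝ V] (v : V) : V →L[ℝ] ℂ :=
  Complex.ofRealCLM ∘L innerSL ℝ v

lemma rl_apply {V : Type*} [NormedAddCommGroup V] [InnerProductSpace ℝ V] (v w : V) :
    rl v w = ((inner ℝ v w : ℝ) : ℂ) := rfl

lemma TF.integrable {u : X → ℂ} (h : TF u) : Integrable u :=
  h.smooth.continuous.integrable_of_hasCompactSupport h.supp

lemma fourier_sum {ι : Type*} (s : Finset ι) (c : ι → ℂ) (g : ι → X → ℂ)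
    (h : ∀ i ∈ s, TF (g i)) (ξ : X) :
    𝓕 (fun x => ∑ i ∈ s, c i * g i x) ξ = ∑ i ∈ s, c i * 𝓕 (g i) ξ := by
  simp only [Real.fourier_eq', Finset.smul_sum]
  rw [integral_finsetSum]
  · apply Finset.sum_congr rfl
    intro i _
    rw [← integral_const_mul]
    congr 1
    ext x
    simp only [smul_eq_mul]
    ring
  · intro i hi
    have := ((Real.fourierIntegral_convergent_iff (μ := volume) ξ).2
      ((h i hi).integrable.const_mul (c i)))
    simp only [Circle.smul_def, Real.fourierChar_apply] at this
    refine this.congr (Filter.Eventually.of_forall fun x => ?_)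
    simp only [smul_eq_mul]
    congr 2
    push_cast
    ring

lemma TF.opApply (k : ℕ) (A : (Fin n → ℕ) → (V →ₗ[ℝ] E)) {u : X → V} (h : TF u) :
    TF (opApply k A u) := by
  unfold _root_.opApply
  apply TF.sum
  intro α _
  exact (h.pdMulti α).clm (LinearMap.toContinuousLinearMap (A α))

lemma fourier_op (k : ℕ) (A : (Fin n → ℕ) → (V →ₗ[ℝ] E)) {u : X → V} (h : TF u) {ι : Type*}
    [Fintype ι] (b : OrthonormalBasis ι ℝ V) (w : E) (ξ : X) :
    𝓕 (fun x => rl w (opApply k A u x)) ξ = (2 * Real.pi * Complex.I) ^ k *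
      ∑ i, ((inner ℝ w (sg k A ξ (b i)) : ℝ) : ℂ) * 𝓕 (fun x => rl (b i) (u x)) ξ := by
  have h1 : (fun x => rl w (opApply k A u x)) = fun x =>
      ∑ q ∈ Finset.Nat.antidiagonalTuple n k ×ˢ (Finset.univ : Finset ι),
        ((inner ℝ w (A q.1 (b q.2)) : ℝ) : ℂ) * pdMulti q.1 (fun x => rl (b q.2) (u x)) x := by
    ext x
    rw [Finset.sum_product]
    simp only [opApply, map_sum]
    apply Finset.sum_congr rfl
    intro α _
    have e : A α (pdMulti α u x) = ∑ i, inner ℝ (b i) (pdMulti α u x) • A α (b i) := by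
      conv_lhs => rw [← b.sum_repr' (pdMulti α u x)]
      simp only [map_sum, map_smul]
    rw [e, map_sum]
    apply Finset.sum_congr rfl
    intro i _
    rw [pdMulti_clm h]
    simp only [rl_apply, inner_smul_right]
    push_cast
    ring
  have h2 := fourier_sum (Finset.Nat.antidiagonalTuple n k ×ˢ (Finset.univ : Finset ι))
    (fun q => ((inner ℝ w (A q.1 (b q.2)) : ℝ) : ℂ))
    (fun q => pdMulti q.1 (fun x => rl (b q.2) (u x))) (fun q _ => (h.clm _).pdMulti _) ξ
  rw [h1, h2, Finset.sum_product, Finset.sum_comm, Finset.mul_sum]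
  apply Finset.sum_congr rfl
  intro i _
  simp only [sg, pol, ContinuousLinearMap.sum_apply, _root_.smul_apply, inner_sum,
    inner_smul_right, LinearMap.coe_toContinuousLinearMap']
  push_cast
  rw [Finset.sum_mul, Finset.mul_sum]
  apply Finset.sum_congr rfl
  intro α hα
  rw [Finset.Nat.mem_antidiagonalTuple] at hα
  rw [fourier_pdMulti (h.clm _), hα]
  push_cast
  ring

lemma fourier_rec (k : ℕ) {A : (Fin n → ℕ) → (V →ₗ[ℝ] E)} {u : X → V} (h : TF u)
    {ι κ : Type*} [Fintype ι] [Fintype κ] (b : OrthonormalBasis ι ℝ V)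
    (e : OrthonormalBasis κ ℝ E) (s : Fin k → Fin n) (i : ι) {ξ : X}
    (hi : Function.Injective (symb k A ξ)) :
    𝓕 (ds s (fun x => rl (b i) (u x))) ξ =
      ∑ j, mul0 k A s (b i) (e j) ξ * 𝓕 (fun x => rl (e j) (opApply k A u x)) ξ := by
  classical
  have key : ∀ l, ∑ j, inner ℝ (b i) (Rinv k A ξ (e j)) * inner ℝ (e j) (sg k A ξ (b l))
      = if i = l then 1 else 0 := by
    intro l
    have h1 : ∑ j, inner ℝ (b i) (Rinv k A ξ (e j)) * inner ℝ (e j) (sg k A ξ (b l))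
        = inner ℝ (b i) (Rinv k A ξ (sg k A ξ (b l))) := by
      conv_rhs => rw [← e.sum_repr' (sg k A ξ (b l))]
      simp only [map_sum, map_smul, inner_sum, inner_smul_right]
      exact Finset.sum_congr rfl fun j _ => mul_comm _ _
    rw [h1, Rinv_sg hi, b.inner_eq_ite]
  rw [fourier_ds s (h.clm _)]
  simp only [fourier_op k A h b]
  have : ∀ j, mul0 k A s (b i) (e j) ξ * ((2 * Real.pi * Complex.I) ^ k *
      ∑ l, ((inner ℝ (e j) (sg k A ξ (b l)) : ℝ) : ℂ) * 𝓕 (fun x => rl (b l) (u x)) ξ)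
      = ∑ l, (2 * Real.pi * Complex.I) ^ k * ((∏ l, ξ (s l) : ℝ) : ℂ) *
        (((inner ℝ (b i) (Rinv k A ξ (e j)) * inner ℝ (e j) (sg k A ξ (b l)) : ℝ) : ℂ) *
          𝓕 (fun x => rl (b l) (u x)) ξ) := by
    intro j
    rw [Finset.mul_sum, Finset.mul_sum]
    apply Finset.sum_congr rfl
    intro l _
    unfold mul0
    push_cast
    ring
  simp only [this]
  rw [Finset.sum_comm]
  simp only [← Finset.mul_sum, ← Finset.sum_mul, ← Complex.ofReal_sum, key]
  congr 1
  rw [Finset.sum_eq_single i]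
  · simp
  · intro l _ hl
    simp [Ne.symm hl]
  · simp

lemma mulF_integrable (hn : 1 ≤ n) {m : X → ℂ} {M : ℝ} (hm : IsMult m M) {f : X → ℂ}
    (h : TF f) : Integrable (fun ξ => m ξ * 𝓕 f ξ) :=
  h.fourier_integrable.bdd_mul (hm.aesm hn) (Filter.Eventually.of_forall hm.bdd)

lemma finv_integrand {g : X → ℂ} (hg : Integrable g) (x : X) :
    Integrable (fun v : X => Complex.exp (((2 * Real.pi * inner ℝ v x : ℝ) : ℂ) * Complex.I) • g v) := by
  have := (Real.fourierIntegral_convergent_iff (μ := volume) (-x)).2 hg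
  simp only [Circle.smul_def, Real.fourierChar_apply] at this
  refine this.congr (Filter.Eventually.of_forall fun v => ?_)
  simp only [smul_eq_mul, inner_neg_right, neg_neg]

lemma finv_sum {ι : Type*} (s : Finset ι) (g : ι → X → ℂ) (h : ∀ i ∈ s, Integrable (g i)) (x : X) :
    𝓕⁻ (fun ξ => ∑ i ∈ s, g i ξ) x = ∑ i ∈ s, 𝓕⁻ (g i) x := by
  simp only [Real.fourierInv_eq', Finset.smul_sum]
  rw [integral_finsetSum]
  intro i hi
  exact finv_integrand (h i hi) x

lemma finv_continuous {g : X → ℂ} (hg : Integrable g) : Continuous (𝓕⁻ g) := by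
  have : 𝓕⁻ g = fun x => 𝓕 g (-x) := by
    ext x; rw [Real.fourierInv_eq_fourier_neg]
  rw [this]
  have h2 : Continuous (𝓕 g) :=
    VectorFourier.fourierIntegral_continuous Real.continuous_fourierChar
      (L := innerₗ X) continuous_inner hg
  exact h2.comp continuous_neg

lemma ds_rec (hn : 1 ≤ n) (k : ℕ) {A : (Fin n → ℕ) → (V →ₗ[ℝ] E)}
    (hell : ∀ ξ : X, ξ ≠ 0 → Function.Injective (symb k A ξ)) {u : X → V} (h : TF u)
    {ι κ : Type*} [Fintype ι] [Fintype κ] (b : OrthonormalBasis ι ℝ V)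
    (e : OrthonormalBasis κ ℝ E) (s : Fin k → Fin n) (i : ι) (x : X) :
    ds s (fun x => rl (b i) (u x)) x =
      ∑ j, 𝓕⁻ (fun ξ => mul0 k A s (b i) (e j) ξ *
        𝓕 (fun x => rl (e j) (opApply k A u x)) ξ) x := by
  have : Nonempty (Fin n) := ⟨⟨0, hn⟩⟩
  rw [((h.clm _).ds s).inv x, ← finv_sum Finset.univ]
  · simp only [Real.fourierInv_eq']
    apply integral_congr_ae
    have : ∀ᵐ ξ : X, ξ ≠ 0 := by
      simp [ae_iff]
    filter_upwards [this] with ξ hξ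
    rw [fourier_rec k h b e s i (hell ξ hξ)]
  · intro j _
    obtain ⟨M, hM⟩ := mul0_isMult k hell s (b i) (e j)
    exact mulF_integrable hn hM ((h.opApply k A).clm _)

lemma norm_le_rl {ι : Type*} [Fintype ι] (b : OrthonormalBasis ι ℝ V) (w : V) :
    ‖w‖ ≤ ∑ i, ‖rl (b i) w‖ := by
  conv_lhs => rw [← b.sum_repr' w]
  refine (norm_sum_le _ _).trans (Finset.sum_le_sum fun i _ => ?_)
  rw [norm_smul, b.norm_eq_one, mul_one, rl_apply, Complex.norm_real]

lemma norm_rl_le {ι : Type*} [Fintype ι] (b : OrthonormalBasis ι ℝ V) (i : ι) (w : V) :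
    ‖rl (b i) w‖ ≤ ‖w‖ := by
  rw [rl_apply, Complex.norm_real]
  exact (norm_inner_le_norm _ _).trans (by rw [b.norm_eq_one, one_mul])

lemma pointwise (hn : 1 ≤ n) (k : ℕ) {A : (Fin n → ℕ) → (V →ₗ[ℝ] E)}
    (hell : ∀ ξ : X, ξ ≠ 0 → Function.Injective (symb k A ξ)) {u : X → V} (h : TF u)
    {ι κ : Type*} [Fintype ι] [Fintype κ] (b : OrthonormalBasis ι ℝ V)
    (e : OrthonormalBasis κ ℝ E) (x : X) :
    ‖iteratedFDeriv ℝ k u x‖ₑ ≤ ∑ q : (Fin k → Fin n) × ι × κ,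
      ‖𝓕⁻ (fun ξ => mul0 k A q.1 (b q.2.1) (e q.2.2) ξ *
        𝓕 (fun x => rl (e q.2.2) (opApply k A u x)) ξ) x‖ₑ := by
  have : ‖iteratedFDeriv ℝ k u x‖ ≤ ∑ q : (Fin k → Fin n) × ι × κ,
      ‖𝓕⁻ (fun ξ => mul0 k A q.1 (b q.2.1) (e q.2.2) ξ *
        𝓕 (fun x => rl (e q.2.2) (opApply k A u x)) ξ) x‖ := by
    refine (norm_iteratedFDeriv_le k u x).trans ?_
    rw [Fintype.sum_prod_type]
    refine Finset.sum_le_sum fun s _ => ?_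
    rw [Fintype.sum_prod_type]
    refine (norm_le_rl b _).trans (Finset.sum_le_sum fun i _ => ?_)
    have e1 := congrFun (ds_clm s h (rl (b i))) x
    rw [← e1, ds_rec hn k hell h b e]
    exact norm_sum_le _ _
  rw [← ofReal_norm]
  refine (ENNReal.ofReal_le_ofReal this).trans ?_
  rw [ENNReal.ofReal_sum_of_nonneg (fun _ _ => norm_nonneg _)]
  simp only [ofReal_norm]
  exact le_rfl

theorem main (hn : 1 ≤ n) (k : ℕ) {p : ℝ} (hp : 1 < p) {A : (Fin n → ℕ) → (V →ₗ[ℝ] E)}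
    (hell : ∀ ξ : X, ξ ≠ 0 → Function.Injective (symb k A ξ)) :
    ∃ C : ℝ≥0∞, C ≠ ⊤ ∧ ∀ u : X → V, TF u →
      ∫⁻ x, ‖iteratedFDeriv ℝ k u x‖ₑ ^ p ≤ C * ∫⁻ x, ‖opApply k A u x‖ₑ ^ p := by
  have hp0 : 0 ≤ p := by linarith
  let b := stdOrthonormalBasis ℝ V
  let e := stdOrthonormalBasis ℝ E
  have hM := fun q : (Fin k → Fin n) × Fin (Module.finrank ℝ V) × Fin (Module.finrank ℝ E) =>
    mul0_isMult k hell q.1 (b q.2.1) (e q.2.2)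
  choose M hM using hM
  have hC := fun q => multiplier hn (hM q) hp
  choose C hCt hC using hC
  refine ⟨(Finset.univ : Finset ((Fin k → Fin n) × Fin (Module.finrank ℝ V) ×
    Fin (Module.finrank ℝ E))).card ^ (p - 1) * ∑ q, C q, ?_, fun u hu => ?_⟩
  · refine ENNReal.mul_ne_top ?_ ?_
    · exact ENNReal.rpow_ne_top_of_nonneg (by linarith) (ENNReal.natCast_ne_top _)
    · exact ENNReal.sum_ne_top.2 fun q _ => hCt q
  have hf : ∀ j, TF (fun x => rl (e j) (opApply k A u x)) := fun j => (hu.opApply k A).clm _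
  set N := (Finset.univ : Finset ((Fin k → Fin n) × Fin (Module.finrank ℝ V) ×
    Fin (Module.finrank ℝ E))).card
  calc ∫⁻ x, ‖iteratedFDeriv ℝ k u x‖ₑ ^ p
      ≤ ∫⁻ x, (N : ℝ≥0∞) ^ (p - 1) * ∑ q : (Fin k → Fin n) × Fin (Module.finrank ℝ V) ×
          Fin (Module.finrank ℝ E), ‖𝓕⁻ (fun ξ => mul0 k A q.1 (b q.2.1) (e q.2.2) ξ *
        𝓕 (fun x => rl (e q.2.2) (opApply k A u x)) ξ) x‖ₑ ^ p := by
        refine lintegral_mono fun x => ?_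
        exact (ENNReal.rpow_le_rpow (pointwise hn k hell hu b e x) hp0).trans
          (ENNReal.rpow_sum_le_const_mul_sum_rpow _ _ hp.le)
    _ = (N : ℝ≥0∞) ^ (p - 1) * ∑ q : (Fin k → Fin n) × Fin (Module.finrank ℝ V) ×
          Fin (Module.finrank ℝ E), ∫⁻ x, ‖𝓕⁻ (fun ξ => mul0 k A q.1 (b q.2.1) (e q.2.2) ξ *
        𝓕 (fun x => rl (e q.2.2) (opApply k A u x)) ξ) x‖ₑ ^ p := by
        rw [lintegral_const_mul', lintegral_finsetSum]
        · intro q _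
          exact (finv_continuous (mulF_integrable hn (hM q) (hf _))).measurable.enorm.pow_const _
        · exact ENNReal.rpow_ne_top_of_nonneg (by linarith) (ENNReal.natCast_ne_top _)
    _ ≤ (N : ℝ≥0∞) ^ (p - 1) * ∑ q, C q * ∫⁻ x, ‖opApply k A u x‖ₑ ^ p := by
        gcongr with q _
        refine (hC q _ (hf _).smooth (hf _).supp).trans ?_
        gcongr with x
        rw [← ofReal_norm, ← ofReal_norm]
        exact ENNReal.ofReal_le_ofReal (norm_rl_le e _ _)
    _ = _ := by rw [← Finset.sum_mul, mul_assoc]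

lemma lint_eq {W : Type*} [NormedAddCommGroup W] {g : X → W} (hg : Continuous g)
    (hc : HasCompactSupport g) {p : ℝ} (hp : 1 < p) :
    ENNReal.ofReal (∫ x, ‖g x‖ ^ p) = ∫⁻ x, ‖g x‖ₑ ^ p := by
  have hp0 : 0 < p := by linarith
  rw [ofReal_integral_eq_lintegral_ofReal]
  · refine lintegral_congr fun x => ?_
    rw [← ofReal_norm, ENNReal.ofReal_rpow_of_nonneg (norm_nonneg _) hp0.le]
  · apply Continuous.integrable_of_hasCompactSupport
    · exact hg.norm.rpow_const fun _ => Or.inr hp0.le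
    · exact hc.comp_left (g := fun w : W => ‖w‖ ^ p) (by simp [hp0.ne'])
  · exact Filter.Eventually.of_forall fun x => by positivity

end P11
end CZ

/-- Calderón–Zygmund estimate: for `A(D)` injectively elliptic of order `k` and
`1 < p < ∞`, one has `∫ |D^k u|^p ≤ C ∫ |A(D)u|^p` for all `u ∈ C^∞_c(ℝⁿ, V)`. -/
theorem stmt2
    {V E : Type*} [NormedAddCommGroup V] [InnerProductSpace ℝ V] [FiniteDimensional ℝ V]
    [NormedAddCommGroup E] [InnerProductSpace ℝ E] [FiniteDimensional ℝ E]
    (n k : ℕ) (hn : 1 ≤ n) (hk : 1 ≤ k) (p : ℝ) (hp : 1 < p)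
    (A : (Fin n → ℕ) → (V →ₗ[ℝ] E))
    (hell : ∀ ξ : EuclideanSpace ℝ (Fin n), ξ ≠ 0 → Function.Injective (symb k A ξ)) :
    ∃ C : ℝ, 0 < C ∧ ∀ u : EuclideanSpace ℝ (Fin n) → V,
      ContDiff ℝ (⊤ : ℕ∞) u → HasCompactSupport u →
      ∫ x, ‖iteratedFDeriv ℝ k u x‖ ^ p ≤ C * ∫ x, ‖opApply k A u x‖ ^ p := by
  obtain ⟨C, hCt, hC⟩ := CZ.main hn k hp hell
  refine ⟨C.toReal + 1, by positivity, fun u hu hc => ?_⟩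
  have h : CZ.TF u := ⟨hu, hc⟩
  have h1 := hC u h
  have hop := h.opApply k A
  have hcont : Continuous (iteratedFDeriv ℝ k u) :=
    hu.continuous_iteratedFDeriv (by exact_mod_cast le_top)
  rw [← CZ.lint_eq hcont (hc.iteratedFDeriv k) hp,
    ← CZ.lint_eq hop.smooth.continuous hop.supp hp, ← ENNReal.ofReal_toReal hCt,
    ← ENNReal.ofReal_mul ENNReal.toReal_nonneg] at h1
  have hI : 0 ≤ ∫ x, ‖opApply k A u x‖ ^ p := integral_nonneg fun x => by positivity
  rw [ENNReal.ofReal_le_ofReal_iff (mul_nonneg ENNReal.toReal_nonneg hI)] at h1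
  linarith
end
end
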